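/- Let n ≥ 1 and 1 ≤ l ≤ m. If there exists an S³-equivariant continuous map from the unit sphere S^{4n−1} of ℍⁿ to the quaternionic Stiefel manifold ℍV_{m,l} (equivariant with respect to the unit-quaternion actions by left scalar multiplication), then n ≤ m − l + 1. -/

import Mathlib

open scoped Quaternion
open Matrix

/-- The quaternionic Stiefel manifold `ℍV_{n,k}` of orthonormal `k`-frames in `ℍⁿ`,
realized as the space of `k × n` quaternionic matrices `A` with `A * Aᴴ = 1`, with the
subspace topology from the space of matrices. -/
abbrev QStiefel (n k : ℕ) : Type :=
  {A : Matrix (Fin k) (Fin n) ℍ[ℝ] // A * Aᴴ = 1}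

/-- The unit sphere `S^{4n-1}` in quaternionic `n`-space `ℍⁿ` (with the Euclidean
`L²` norm). -/
abbrev QSphere (n : ℕ) : Type :=
  Metric.sphere (0 : PiLp 2 fun _ : Fin n => ℍ[ℝ]) 1

open MeasureTheory Metric Set in
/-- Integration in polar coordinates of a product of an angular and a radial function. -/
lemma integral_sphere_mul_radial {E : Type*} [NormedAddCommGroup E] [NormedSpace ℝ E]
    [MeasurableSpace E] [BorelSpace E] [FiniteDimensional ℝ E] [Nontrivial E]
    (μ : Measure E) [μ.IsAddHaarMeasure] (g : sphere (0 : E) 1 → ℝ) (h : ℝ → ℝ) (F : E → ℝ)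
    (hF : ∀ (x : sphere (0 : E) 1) (r : ℝ), 0 < r → F (r • x.1) = g x * h r) :
    ∫ x, F x ∂μ = (∫ x, g x ∂μ.toSphere) *
      ∫ y in Ioi (0 : ℝ), y ^ (Module.finrank ℝ E - 1) * h y := by
  calc
    ∫ x, F x ∂μ = ∫ x : ({(0)}ᶜ : Set E), F x.1 ∂(μ.comap (↑)) := by
      rw [integral_subtype_comap (measurableSet_singleton _).compl F, restrict_compl_singleton]
    _ = ∫ x, g x.1 * h x.2.1 ∂μ.toSphere.prod (.volumeIoiPow (Module.finrank ℝ E - 1)) := by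
      rw [← μ.measurePreserving_homeomorphUnitSphereProd.integral_comp
        (Homeomorph.measurableEmbedding _)]
      congr 1
      ext x
      rw [← hF _ _ (homeomorphUnitSphereProd E x).2.2]
      congr 1
      have := (homeomorphUnitSphereProd E).symm_apply_apply x
      conv_lhs => rw [← this]
      rfl
    _ = _ := by
      rw [integral_prod_mul (f := fun x => g x) (g := fun y : Ioi (0 : ℝ) => h y.1)]
      congr 1
      simp only [Measure.volumeIoiPow, ENNReal.ofReal]
      rw [integral_withDensity_eq_integral_smul,
        integral_subtype_comap measurableSet_Ioi fun a ↦
          Real.toNNReal (a ^ (Module.finrank ℝ E - 1)) • h a,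
        setIntegral_congr_fun measurableSet_Ioi fun x hx ↦ ?_]
      · rw [NNReal.smul_def, Real.coe_toNNReal _ (pow_nonneg hx.out.le _), smul_eq_mul]
      · exact (measurable_subtype_coe.pow_const _).real_toNNReal

open MeasureTheory in
lemma integral_prod_norm_pow_mul_gaussian {ι : Type*} [Fintype ι] (α : ι → ℕ) :
    ∫ x : ι → ℂ, ∏ i, (‖x i‖ ^ (2 * α i) * Real.exp (-‖x i‖ ^ 2)) =
      Real.pi ^ Fintype.card ι * ∏ i, ((α i).factorial : ℝ) := by
  rw [integral_fintype_prod_volume_eq_prod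
    (fun i (z : ℂ) => ‖z‖ ^ (2 * α i) * Real.exp (-‖z‖ ^ 2))]
  rw [← Finset.card_univ, ← Finset.prod_const, ← Finset.prod_mul_distrib]
  refine Finset.prod_congr rfl fun i _ => ?_
  have := Complex.integral_rpow_mul_exp_neg_rpow (p := 2) (q := ((2 * α i : ℕ) : ℝ)) (by norm_num)
    (by have : (0 : ℝ) ≤ ((2 * α i : ℕ) : ℝ) := by positivity
        linarith)
  simp only [Real.rpow_natCast, Real.rpow_two] at this
  rw [this, show (((2 * α i : ℕ) : ℝ) + 2) / 2 = α i + 1 by push_cast; ring,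
    Real.Gamma_nat_eq_factorial]
  ring

open MeasureTheory in
lemma integral_radial_moment (n : ℕ) :
    ∫ y in Set.Ioi (0 : ℝ), y ^ (2 * n + 1) * Real.exp (-y ^ 2) = (n.factorial : ℝ) / 2 := by
  have := integral_rpow_mul_exp_neg_rpow (p := 2) (q := ((2 * n + 1 : ℕ) : ℝ)) (by norm_num)
    (by have : (0 : ℝ) ≤ ((2 * n + 1 : ℕ) : ℝ) := by positivity
        linarith)
  simp only [Real.rpow_natCast, Real.rpow_two] at this
  rw [this, show (((2 * n + 1 : ℕ) : ℝ) + 1) / 2 = n + 1 by push_cast; ring,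
    Real.Gamma_nat_eq_factorial]
  ring

open MeasureTheory Metric Set Pointwise in
/-- A linear isometry preserving a Haar measure preserves the induced measure on the sphere. -/
lemma toSphere_measurePreserving {E : Type*} [NormedAddCommGroup E] [NormedSpace ℝ E]
    [MeasurableSpace E] [BorelSpace E] [FiniteDimensional ℝ E]
    (μ : Measure E) [μ.IsAddHaarMeasure] (L : E ≃ₗᵢ[ℝ] E) (hL : MeasurePreserving L μ μ)
    (g : sphere (0 : E) 1 → sphere (0 : E) 1) (hg : ∀ x, (g x).1 = L x.1) :
    MeasurePreserving g μ.toSphere μ.toSphere := by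
  have hgc : Continuous g := by
    rw [continuous_induced_rng]
    have : Subtype.val ∘ g = fun x => L x.1 := funext hg
    rw [this]
    fun_prop
  refine ⟨hgc.measurable, ?_⟩
  ext s hs
  rw [Measure.map_apply hgc.measurable hs, Measure.toSphere_apply' _ hs,
    Measure.toSphere_apply' _ (hgc.measurable hs)]
  congr 1
  rw [← hL.measure_preimage_equiv (f := L.toHomeomorph.toMeasurableEquiv)
    (Ioo (0 : ℝ) 1 • (Subtype.val '' s))]
  congr 1
  ext x
  simp only [mem_smul, mem_image, mem_preimage, Subtype.exists, exists_and_right, exists_eq_right]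
  constructor
  · rintro ⟨r, hr, y, ⟨hy, hy'⟩, rfl⟩
    refine ⟨r, hr, L y, ⟨by simpa using hy, ?_⟩, ?_⟩
    · convert hy'
      exact (hg ⟨y, hy⟩).symm
    · exact (L.map_smul r y).symm
  · rintro ⟨r, hr, y, ⟨hy, hy'⟩, h⟩
    refine ⟨r, hr, L.symm y, ⟨by simpa using hy, ?_⟩, ?_⟩
    · convert hy'
      rw [hg]
      exact L.apply_symm_apply y
    · rw [← L.symm.map_smul, h]
      exact L.symm_apply_apply x

open MeasureTheory Metric Set in
/-- The rotation invariant measure on the unit sphere of `ℂ^ι` and its moments. -/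
lemma exists_sphere_measure (ι : Type) [Fintype ι] [Nonempty ι] :
    ∃ μ : Measure (sphere (0 : EuclideanSpace ℂ ι) 1), IsFiniteMeasure μ ∧
      (∀ t : ι → ℂ, (∀ i, ‖t i‖ = 1) →
        ∀ g : sphere (0 : EuclideanSpace ℂ ι) 1 → sphere (0 : EuclideanSpace ℂ ι) 1,
          (∀ x i, (g x).1 i = t i * x.1 i) → MeasurePreserving g μ μ) ∧
      ∃ C : ℝ, 0 < C ∧ ∀ α : ι → ℕ, ∫ x, ∏ i, ‖x.1 i‖ ^ (2 * α i) ∂μ =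
        C * (∏ i, ((α i).factorial : ℝ)) / ((∑ i, α i) + (Fintype.card ι - 1)).factorial := by
  classical
  let L := (PiLp.continuousLinearEquiv 2 ℝ (fun _ : ι => ℂ)).symm
  let μ : Measure (EuclideanSpace ℂ ι) := Measure.map L volume
  have hμ : μ.IsAddHaarMeasure := L.isAddHaarMeasure_map volume
  have hLp : MeasurePreserving L volume μ := ⟨L.continuous.measurable, rfl⟩
  refine ⟨μ.toSphere, inferInstance, ?_, 2 * Real.pi ^ Fintype.card ι, by positivity, ?_⟩
  · intro t ht g hg
    have ht0 : ∀ i, t i ≠ 0 := fun i h => by simpa [h] using ht i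
    let R : ∀ i, ℂ ≃ₗᵢ[ℝ] ℂ := fun i => rotation ⟨t i, by simp [Submonoid.unitSphere, ht i]⟩
    have hR : ∀ i z, R i z = t i * z := fun i z => rfl
    let M : EuclideanSpace ℂ ι ≃ₗᵢ[ℝ] EuclideanSpace ℂ ι := LinearIsometryEquiv.piLpCongrRight 2 R
    refine toSphere_measurePreserving μ M ?_ g ?_
    · have h1 : MeasurePreserving (fun x : ι → ℂ => fun i => R i (x i)) volume volume :=
        volume_preserving_pi fun i => (R i).measurePreserving
      refine ⟨M.continuous.measurable, ?_⟩
      have : M ∘ L = L ∘ (fun x : ι → ℂ => fun i => R i (x i)) := by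
        ext x i
        rfl
      rw [Measure.map_map M.continuous.measurable L.continuous.measurable, this,
        ← Measure.map_map L.continuous.measurable h1.measurable, h1.map_eq]
    · intro x
      ext i
      rw [hg]
      rfl
  · intro α
    set k := ∑ i, α i with hk
    have hc : 0 < Fintype.card ι := Fintype.card_pos
    have hd : Module.finrank ℝ (EuclideanSpace ℂ ι) = 2 * Fintype.card ι := by
      rw [← Module.finrank_mul_finrank ℝ ℂ (EuclideanSpace ℂ ι), Complex.finrank_real_complex,
        finrank_euclideanSpace]
    have hnorm : ∀ x : EuclideanSpace ℂ ι, ‖x‖ ^ 2 = ∑ i, ‖x i‖ ^ 2 :=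
      fun x => EuclideanSpace.norm_sq_eq x
    have key := integral_sphere_mul_radial μ (fun x => ∏ i, ‖x.1 i‖ ^ (2 * α i))
      (fun r => r ^ (2 * k) * Real.exp (-r ^ 2))
      (fun x => ∏ i, (‖x i‖ ^ (2 * α i) * Real.exp (-‖x i‖ ^ 2))) ?_
    · rw [← hLp.integral_comp L.toHomeomorph.measurableEmbedding] at key
      have h1 : ∀ x : ι → ℂ, ∀ i, (L x) i = x i := fun x i => rfl
      simp only [h1] at key
      rw [integral_prod_norm_pow_mul_gaussian] at key
      have h2 : ∀ y : ℝ, y ^ (Module.finrank ℝ (EuclideanSpace ℂ ι) - 1) *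
          (y ^ (2 * k) * Real.exp (-y ^ 2)) =
          y ^ (2 * (k + (Fintype.card ι - 1)) + 1) * Real.exp (-y ^ 2) := by
        intro y
        rw [← mul_assoc, ← pow_add, hd]
        congr 2
        omega
      simp only [h2] at key
      rw [integral_radial_moment] at key
      rw [eq_div_iff (by positivity)]
      linarith
    · intro x r hr
      have hx : ∑ i, ‖x.1 i‖ ^ 2 = 1 := by
        rw [← hnorm, norm_eq_of_mem_sphere]; norm_num
      simp only [PiLp.smul_apply, norm_smul, Real.norm_of_nonneg hr.le, mul_pow,
        Finset.prod_mul_distrib]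
      rw [← Real.exp_sum, Finset.prod_pow_eq_pow_sum, ← Finset.mul_sum, Finset.sum_neg_distrib,
        ← Finset.mul_sum, hx, ← hk]
      ring_nf

/-- Relative to a linear map `T` and a filtration `P` by subspaces, multiplication by `g` almost
preserves the filtration. -/
def HankelSmall {X : Type*} [TopologicalSpace X] [CompactSpace X]
    {H : Type*} [NormedAddCommGroup H] [InnerProductSpace ℂ H]
    (T : C(X, ℂ) →ₗ[ℂ] H) (P : ℕ → Submodule ℂ C(X, ℂ)) (g : C(X, ℂ)) : Prop :=
  ∀ ε : ℝ, 0 < ε → ∀ K' : ℕ, ∃ K, ∀ p ∈ P K, ∃ q ∈ P K', ‖T (g * p - q)‖ ≤ ε * ‖T p‖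

section Hankel

variable {X : Type*} [TopologicalSpace X] [CompactSpace X]
  {H : Type*} [NormedAddCommGroup H] [InnerProductSpace ℂ H]
  {T : C(X, ℂ) →ₗ[ℂ] H} {P : ℕ → Submodule ℂ C(X, ℂ)}

lemma hankelSmall_algebraMap (c : ℂ) : HankelSmall T P (algebraMap ℂ C(X, ℂ) c) := by
  intro ε hε K'
  refine ⟨K', fun p hp => ⟨c • p, (P K').smul_mem c hp, ?_⟩⟩
  rw [Algebra.algebraMap_eq_smul_one, smul_mul_assoc, one_mul, sub_self, map_zero, norm_zero]
  positivity

lemma HankelSmall.add (hP : Antitone P) {f g : C(X, ℂ)} (hf : HankelSmall T P f)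
    (hg : HankelSmall T P g) : HankelSmall T P (f + g) := by
  intro ε hε K'
  obtain ⟨K₁, h₁⟩ := hf (ε / 2) (by positivity) K'
  obtain ⟨K₂, h₂⟩ := hg (ε / 2) (by positivity) K'
  refine ⟨max K₁ K₂, fun p hp => ?_⟩
  obtain ⟨q₁, hq₁, hn₁⟩ := h₁ p (hP (le_max_left _ _) hp)
  obtain ⟨q₂, hq₂, hn₂⟩ := h₂ p (hP (le_max_right _ _) hp)
  refine ⟨q₁ + q₂, (P K').add_mem hq₁ hq₂, ?_⟩
  have : (f + g) * p - (q₁ + q₂) = (f * p - q₁) + (g * p - q₂) := by ring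
  rw [this, map_add]
  linarith [norm_add_le (T (f * p - q₁)) (T (g * p - q₂))]

lemma HankelSmall.mul (hT : ∀ f g, ‖T (f * g)‖ ≤ ‖f‖ * ‖T g‖) {f g : C(X, ℂ)}
    (hf : HankelSmall T P f) (hg : HankelSmall T P g) : HankelSmall T P (f * g) := by
  intro ε hε K'
  obtain ⟨K₁, h₁⟩ := hf (ε / (2 * (‖g‖ + 1))) (by positivity) K'
  obtain ⟨K₂, h₂⟩ := hg (min 1 (ε / (2 * (‖f‖ + 1)))) (by positivity) K₁
  refine ⟨K₂, fun p hp => ?_⟩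
  obtain ⟨q₂, hq₂, hn₂⟩ := h₂ p hp
  obtain ⟨q₁, hq₁, hn₁⟩ := h₁ q₂ hq₂
  refine ⟨q₁, hq₁, ?_⟩
  have h3 : f * g * p - q₁ = f * (g * p - q₂) + (f * q₂ - q₁) := by ring
  have h4 : ‖T (g * p - q₂)‖ ≤ 1 * ‖T p‖ :=
    hn₂.trans (mul_le_mul_of_nonneg_right (min_le_left _ _) (norm_nonneg _))
  have h5 : ‖T (g * p - q₂)‖ ≤ ε / (2 * (‖f‖ + 1)) * ‖T p‖ :=
    hn₂.trans (mul_le_mul_of_nonneg_right (min_le_right _ _) (norm_nonneg _))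
  have h6 : ‖T q₂‖ ≤ (‖g‖ + 1) * ‖T p‖ := by
    have : q₂ = g * p - (g * p - q₂) := by ring
    rw [this, map_sub]
    linarith [norm_sub_le (T (g * p)) (T (g * p - q₂)), hT g p]
  have h7 : ‖T (f * (g * p - q₂))‖ ≤ ε / 2 * ‖T p‖ := by
    calc _ ≤ ‖f‖ * ‖T (g * p - q₂)‖ := hT _ _
      _ ≤ (‖f‖ + 1) * (ε / (2 * (‖f‖ + 1)) * ‖T p‖) := by gcongr; linarith
      _ = _ := by field_simp
  have h8 : ‖T (f * q₂ - q₁)‖ ≤ ε / 2 * ‖T p‖ := by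
    calc _ ≤ ε / (2 * (‖g‖ + 1)) * ‖T q₂‖ := hn₁
      _ ≤ ε / (2 * (‖g‖ + 1)) * ((‖g‖ + 1) * ‖T p‖) := by gcongr
      _ = _ := by field_simp
  rw [h3, map_add]
  linarith [norm_add_le (T (f * (g * p - q₂))) (T (f * q₂ - q₁))]

lemma hankelSmall_of_mem_closure (hT : ∀ f g, ‖T (f * g)‖ ≤ ‖f‖ * ‖T g‖) {g : C(X, ℂ)}
    (hg : g ∈ closure {g | HankelSmall T P g}) : HankelSmall T P g := by
  intro ε hε K'
  obtain ⟨f, hf, hfg⟩ := Metric.mem_closure_iff.1 hg (ε / 2) (by positivity)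
  obtain ⟨K, h⟩ := hf (ε / 2) (by positivity) K'
  refine ⟨K, fun p hp => ?_⟩
  obtain ⟨q, hq, hn⟩ := h p hp
  refine ⟨q, hq, ?_⟩
  have h3 : g * p - q = (g - f) * p + (f * p - q) := by ring
  have h4 : ‖T ((g - f) * p)‖ ≤ ε / 2 * ‖T p‖ := by
    refine (hT _ _).trans ?_
    rw [dist_eq_norm] at hfg
    gcongr
  rw [h3, map_add]
  linarith [norm_add_le (T ((g - f) * p)) (T (f * p - q))]

/-- If the coordinate functions of a point-separating family and their conjugates are
`HankelSmall`, then so is every continuous function. -/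
lemma hankelSmall_of_separating (hP : Antitone P) (hT : ∀ f g, ‖T (f * g)‖ ≤ ‖f‖ * ‖T g‖)
    {I : Type*} (z : I → C(X, ℂ)) (hz : ∀ i, HankelSmall T P (z i))
    (hz' : ∀ i, HankelSmall T P (star (z i))) (hsep : ∀ x y, (∀ i, z i x = z i y) → x = y)
    (g : C(X, ℂ)) : HankelSmall T P g := by
  let S : Subalgebra ℂ C(X, ℂ) :=
    { carrier := {g | HankelSmall T P g}
      mul_mem' := fun ha hb => HankelSmall.mul hT ha hb
      add_mem' := fun ha hb => HankelSmall.add hP ha hb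
      algebraMap_mem' := hankelSmall_algebraMap }
  have hle : (StarAlgebra.adjoin ℂ (Set.range z)).toSubalgebra ≤ S := by
    rw [StarAlgebra.adjoin_toSubalgebra, Algebra.adjoin_le_iff]
    rintro f (⟨i, rfl⟩ | hf)
    · exact hz i
    · obtain ⟨i, hi⟩ := hf
      have := hz' i
      rw [hi, star_star] at this
      exact this
  have htop := ContinuousMap.starSubalgebra_topologicalClosure_eq_top_of_separatesPoints
    (StarAlgebra.adjoin ℂ (Set.range z)) (by
      intro x y hxy
      by_contra! hcon
      refine hxy (hsep x y fun i => ?_)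
      exact hcon _ ⟨z i, StarAlgebra.subset_adjoin ℂ _ ⟨i, rfl⟩, rfl⟩)
  have hmem : g ∈ (StarAlgebra.adjoin ℂ (Set.range z)).topologicalClosure := by
    rw [htop]; trivial
  exact hankelSmall_of_mem_closure hT (closure_mono hle hmem)

/-- Multiplication by `g` is `HankelSmall` if it is so on the members of an orthogonal family, with
orthogonal errors. -/
lemma hankelSmall_of_orthogonal {A : Type*} (e : A → C(X, ℂ)) (dep : A → ℕ)
    (he : ∀ a b, a ≠ b → inner ℂ (T (e a)) (T (e b)) = 0) (g : C(X, ℂ)) (w : A → C(X, ℂ))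
    (hw : ∀ K', ∃ K, ∀ a, K ≤ dep a → w a ∈ Submodule.span ℂ (e '' {a | K' ≤ dep a}))
    (ho : ∀ a b, a ≠ b → inner ℂ (T (g * e a - w a)) (T (g * e b - w b)) = 0)
    (hs : ∀ ε : ℝ, 0 < ε → ∃ K, ∀ a, K ≤ dep a → ‖T (g * e a - w a)‖ ≤ ε * ‖T (e a)‖) :
    HankelSmall T (fun K => Submodule.span ℂ (e '' {a | K ≤ dep a})) g := by
  intro ε hε K'
  obtain ⟨K₁, h₁⟩ := hw K'
  obtain ⟨K₂, h₂⟩ := hs ε hε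
  refine ⟨max K₁ K₂, fun p hp => ?_⟩
  rw [Finsupp.mem_span_image_iff_linearCombination] at hp
  obtain ⟨c, hc, rfl⟩ := hp
  have hc' : ∀ a ∈ c.support, max K₁ K₂ ≤ dep a := fun a ha =>
    (Finsupp.mem_supported _ _).1 hc ha
  refine ⟨∑ a ∈ c.support, c a • w a, Submodule.sum_mem _ fun a ha =>
    Submodule.smul_mem _ _ (h₁ a ((le_max_left _ _).trans (hc' a ha))), ?_⟩
  rw [Finsupp.linearCombination_apply, Finsupp.sum]
  have key : T (g * ∑ a ∈ c.support, c a • e a - ∑ a ∈ c.support, c a • w a) =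
      ∑ a ∈ c.support, c a • T (g * e a - w a) := by
    rw [Finset.mul_sum, ← Finset.sum_sub_distrib, map_sum]
    refine Finset.sum_congr rfl fun a _ => ?_
    rw [mul_smul_comm, ← smul_sub, map_smul]
  have pyth : ∀ v : A → H, (∀ a b, a ≠ b → inner ℂ (v a) (v b) = 0) →
      ‖∑ a ∈ c.support, c a • v a‖ ^ 2 = ∑ a ∈ c.support, ‖c a‖ ^ 2 * ‖v a‖ ^ 2 := by
    intro v hv
    have hin : ∀ x : H, inner ℂ x x = ((‖x‖ ^ 2 : ℝ) : ℂ) := fun x => by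
      rw [inner_self_eq_norm_sq_to_K, Complex.ofReal_pow]; rfl
    have := hin (∑ a ∈ c.support, c a • v a)
    rw [sum_inner] at this
    have h2 : ∀ a ∈ c.support, inner ℂ (c a • v a) (∑ b ∈ c.support, c b • v b) =
        ((‖c a‖ ^ 2 * ‖v a‖ ^ 2 : ℝ) : ℂ) := by
      intro a ha
      rw [inner_sum, Finset.sum_eq_single a]
      · rw [hin, norm_smul, mul_pow]
      · intro b _ hb
        rw [inner_smul_left, inner_smul_right, hv a b hb.symm, mul_zero, mul_zero]
      · exact fun h => absurd ha h
    rw [Finset.sum_congr rfl h2] at this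
    exact_mod_cast this.symm
  rw [key]
  refine le_of_sq_le_sq ?_ (by positivity)
  rw [map_sum]
  simp only [map_smul]
  rw [mul_pow, pyth _ ho, pyth _ he, Finset.mul_sum]
  refine Finset.sum_le_sum fun a ha => ?_
  have := h₂ a ((le_max_right _ _).trans (hc' a ha))
  calc _ ≤ ‖c a‖ ^ 2 * (ε * ‖T (e a)‖) ^ 2 := by gcongr
    _ = _ := by ring

end Hankel

section Index

variable {X : Type*} [TopologicalSpace X]
  {H : Type*} [NormedAddCommGroup H] [InnerProductSpace ℂ H]
  {T : C(X, ℂ) →ₗ[ℂ] H}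
  {V : Type*} [Fintype V] [DecidableEq V]

lemma sum_norm_sq_mulVec
    (hadj : ∀ f g h, inner ℂ (T f) (T (g * h)) = inner ℂ (T (star g * f)) (T h))
    {D : Matrix V V C(X, ℂ)} (hD : Dᴴ * D = 1) (p : V → C(X, ℂ)) :
    ∑ u, ‖T ((D *ᵥ p) u)‖ ^ 2 = ∑ v, ‖T (p v)‖ ^ 2 := by
  have hin : ∀ x : H, inner ℂ x x = ((‖x‖ ^ 2 : ℝ) : ℂ) := fun x => by
    rw [inner_self_eq_norm_sq_to_K, Complex.ofReal_pow]; rfl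
  apply Complex.ofReal_injective
  push_cast only [Complex.ofReal_sum]
  simp only [← hin]
  have h1 : ∀ u, inner ℂ (T ((D *ᵥ p) u)) (T ((D *ᵥ p) u)) =
      ∑ w, inner ℂ (T (star (D u w) * (D *ᵥ p) u)) (T (p w)) := by
    intro u
    conv_lhs => rw [show (D *ᵥ p) u = ∑ w, D u w * p w from rfl]
    conv_lhs => arg 3; rw [map_sum]
    rw [inner_sum]
    exact Finset.sum_congr rfl fun w _ => hadj _ _ _
  simp only [h1]
  rw [Finset.sum_comm]
  refine Finset.sum_congr rfl fun w _ => ?_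
  rw [← sum_inner, ← map_sum]
  have : ∑ u, star (D u w) * (D *ᵥ p) u = (Dᴴ *ᵥ (D *ᵥ p)) w := rfl
  rw [this, Matrix.mulVec_mulVec, hD, Matrix.one_mulVec]

variable [CompactSpace X]

/-- Half of the vanishing of the index of a unitary odd matrix of `HankelSmall` symbols. -/
lemma card_le_of_hankelSmall {A : Type*} (e : A → C(X, ℂ)) (dep : A → ℕ)
    (he : ∀ a b, a ≠ b → inner ℂ (T (e a)) (T (e b)) = 0) (he0 : ∀ a, T (e a) ≠ 0)
    (hadj : ∀ f g h, inner ℂ (T f) (T (g * h)) = inner ℂ (T (star g * f)) (T h))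
    (D : Matrix V V C(X, ℂ)) (hD : Dᴴ * D = 1)
    (hH : ∀ u v, HankelSmall T (fun K => Submodule.span ℂ (e '' {a | K ≤ dep a})) (D u v))
    (s : V → Prop) [DecidablePred s] (hs : ∀ u v, (s u ↔ s v) → D u v = 0) :
    ∃ K₀, ∀ F : V → Finset A, (∀ v, ∀ a ∈ F v, K₀ ≤ dep a) →
      (∀ u v, ∀ a ∈ F v, ∀ b, b ∉ F u → inner ℂ (T (e b)) (T (D u v * e a)) = 0) →
      ∑ v with s v, (F v).card ≤ ∑ v with ¬ s v, (F v).card := by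
  set ε : ℝ := 1 / (Fintype.card V + 1) with hε
  have hε0 : 0 < ε := by positivity
  choose K hK using fun u v => hH u v ε hε0 0
  refine ⟨∑ u, ∑ v, K u v, fun F hF hc => ?_⟩
  have hKle : ∀ u v, K u v ≤ ∑ u, ∑ v, K u v := fun u v =>
    (Finset.single_le_sum (f := fun v => K u v) (fun _ _ => Nat.zero_le _)
      (Finset.mem_univ v)).trans
    (Finset.single_le_sum (f := fun u => ∑ v, K u v) (fun _ _ => Nat.zero_le _)
      (Finset.mem_univ u))
  have hcard : ∀ t : V → Prop, ∀ _ : DecidablePred t,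
      ∑ v with t v, (F v).card = Fintype.card (Σ v : {v // t v}, F v.1) := by
    intro t _
    rw [Fintype.card_sigma]
    simp only [Fintype.card_coe]
    exact (Finset.sum_subtype (p := t) _ (by simp) fun v => (F v).card)
  rw [hcard s inferInstance, hcard (fun v => ¬ s v) inferInstance]
  let L : ((Σ v : {v // s v}, F v.1) → ℂ) →ₗ[ℂ] ((Σ v : {v // ¬ s v}, F v.1) → ℂ) :=
    LinearMap.pi fun y => (innerSL ℂ (T (e y.2))).toLinearMap ∘ₗ T ∘ₗ
      Fintype.linearCombination ℂ (fun x : (Σ v : {v // s v}, F v.1) => D y.1 x.1 * e x.2)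
  refine card_le_of_injective ℂ L ((injective_iff_map_eq_zero L).2 fun c hLc => ?_)
  let p : V → C(X, ℂ) := fun v => if h : s v then ∑ a : F v, c ⟨⟨v, h⟩, a⟩ • e a else 0
  have hpP : ∀ v K', K' ≤ ∑ u, ∑ v, K u v →
      p v ∈ Submodule.span ℂ (e '' {a | K' ≤ dep a}) := by
    intro v K' hK'
    simp only [p]
    split_ifs with h
    · exact Submodule.sum_mem _ fun a _ => Submodule.smul_mem _ _
        (Submodule.subset_span ⟨a, hK'.trans (hF v a a.2), rfl⟩)
    · exact Submodule.zero_mem _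
  have hG : ∀ u, (D *ᵥ p) u = ∑ x : (Σ v : {v // s v}, F v.1), c x • (D u x.1 * e x.2) := by
    intro u
    rw [Fintype.sum_sigma, show (D *ᵥ p) u = ∑ v, D u v * p v from rfl]
    have : ∀ v, D u v * p v = if h : s v then
        ∑ a : F v, c ⟨⟨v, h⟩, a⟩ • (D u v * e a) else 0 := by
      intro v
      simp only [p]
      split_ifs with h
      · simp only [Finset.mul_sum, mul_smul_comm]
      · exact mul_zero _
    simp only [this]
    rw [← Finset.sum_filter_add_sum_filter_not Finset.univ s]
    have hz : ∑ v with ¬ s v, (if h : s v then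
        ∑ a : F v, c ⟨⟨v, h⟩, a⟩ • (D u v * e a) else 0) = 0 :=
      Finset.sum_eq_zero fun v hv => dif_neg (Finset.mem_filter.1 hv).2
    rw [hz, add_zero, Finset.sum_subtype (p := s) _ (by simp)]
    exact Finset.sum_congr rfl fun v _ => dif_pos v.2
  have hperp : ∀ u b, inner ℂ (T (e b)) (T ((D *ᵥ p) u)) = 0 := by
    intro u b
    by_cases hu : s u
    · rw [hG, Finset.sum_eq_zero, map_zero, inner_zero_right]
      intro x _
      rw [hs u x.1 (by simp [hu, x.1.2]), zero_mul, smul_zero]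
    by_cases hb : b ∈ F u
    · have := congrFun hLc ⟨⟨u, hu⟩, ⟨b, hb⟩⟩
      rw [hG]
      exact this
    · rw [hG, map_sum, inner_sum]
      refine Finset.sum_eq_zero fun x _ => ?_
      rw [map_smul, inner_smul_right, hc u x.1 x.2 x.2.2 b hb, mul_zero]
  have hperp' : ∀ u, ∀ q ∈ Submodule.span ℂ (e '' {a | 0 ≤ dep a}),
      inner ℂ (T q) (T ((D *ᵥ p) u)) = 0 := by
    intro u q hq
    induction hq using Submodule.span_induction with
    | mem x hx => obtain ⟨a, _, rfl⟩ := hx; exact hperp u a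
    | zero => rw [map_zero, inner_zero_left]
    | add x y _ _ hx hy => rw [map_add, inner_add_left, hx, hy, add_zero]
    | smul a x _ hx => rw [map_smul, inner_smul_left, hx, mul_zero]
  set S := ∑ v, ‖T (p v)‖ with hS
  have hle : ∀ u, ‖T ((D *ᵥ p) u)‖ ≤ ε * S := by
    intro u
    choose q hq hn using fun v => hK u v (p v) (hpP v _ (hKle u v))
    have h1 : ‖T ((D *ᵥ p) u)‖ ^ 2 ≤
        ‖T ((D *ᵥ p) u - ∑ v, q v)‖ * ‖T ((D *ᵥ p) u)‖ := by
      have h2 : inner ℂ (T ((D *ᵥ p) u - ∑ v, q v)) (T ((D *ᵥ p) u)) =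
          inner ℂ (T ((D *ᵥ p) u)) (T ((D *ᵥ p) u)) := by
        rw [map_sub, inner_sub_left, hperp' u _ (Submodule.sum_mem _ fun v _ => hq v), sub_zero]
      have h3 := norm_inner_le_norm (𝕜 := ℂ) (T ((D *ᵥ p) u - ∑ v, q v)) (T ((D *ᵥ p) u))
      rw [h2, inner_self_eq_norm_sq_to_K] at h3
      simpa using h3
    have h4 : ‖T ((D *ᵥ p) u - ∑ v, q v)‖ ≤ ε * S := by
      rw [show (D *ᵥ p) u = ∑ v, D u v * p v from rfl, ← Finset.sum_sub_distrib, map_sum, hS,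
        Finset.mul_sum]
      exact (norm_sum_le _ _).trans (Finset.sum_le_sum fun v _ => hn v)
    rcases (norm_nonneg (T ((D *ᵥ p) u))).eq_or_lt with h0 | h0
    · rw [← h0, hS]; positivity
    · rw [sq] at h1
      exact (le_of_mul_le_mul_right h1 h0).trans h4
  have hiso := sum_norm_sq_mulVec hadj hD p
  have hCS : S ^ 2 ≤ Fintype.card V * ∑ v, ‖T (p v)‖ ^ 2 := by
    have := sq_sum_le_card_mul_sum_sq (s := Finset.univ) (f := fun v => ‖T (p v)‖)
    simpa using this
  have hM : ∑ v, ‖T (p v)‖ ^ 2 ≤ Fintype.card V * (ε * S) ^ 2 := by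
    rw [← hiso]
    calc _ ≤ ∑ _u : V, (ε * S) ^ 2 := Finset.sum_le_sum fun u _ => by gcongr; exact hle u
      _ = _ := by simp
  have hM0 : ∑ v, ‖T (p v)‖ ^ 2 = 0 := by
    set M := ∑ v, ‖T (p v)‖ ^ 2
    have hMnn : 0 ≤ M := Finset.sum_nonneg fun v _ => by positivity
    have h5 : M ≤ (Fintype.card V * ε) ^ 2 * M := by
      calc M ≤ Fintype.card V * (ε * S) ^ 2 := hM
        _ = Fintype.card V * ε ^ 2 * S ^ 2 := by ring
        _ ≤ Fintype.card V * ε ^ 2 * (Fintype.card V * M) := by gcongr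
        _ = _ := by ring
    have h6 : (Fintype.card V * ε : ℝ) < 1 := by
      rw [hε, mul_one_div, div_lt_one (by positivity)]; linarith
    have h7 : (Fintype.card V * ε : ℝ) ^ 2 < 1 := by
      have : 0 ≤ (Fintype.card V * ε : ℝ) := by positivity
      nlinarith
    by_contra hne
    have : 0 < M := lt_of_le_of_ne hMnn (Ne.symm hne)
    nlinarith
  have hp0 : ∀ v, T (p v) = 0 := fun v => by
    have := (Finset.sum_eq_zero_iff_of_nonneg fun v _ => by positivity).1 hM0 v (Finset.mem_univ v)
    simpa using this
  funext ⟨⟨v, hv⟩, ⟨a, ha⟩⟩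
  have h8 : inner ℂ (T (e a)) (T (p v)) = 0 := by rw [hp0, inner_zero_right]
  simp only [p, dif_pos hv, map_sum, inner_sum] at h8
  rw [Finset.sum_eq_single (⟨a, ha⟩ : F v)] at h8
  · rw [map_smul, inner_smul_right, mul_eq_zero, inner_self_eq_zero] at h8
    exact h8.resolve_right (he0 a)
  · intro b _ hb
    rw [map_smul, inner_smul_right, he a b (fun h => hb (Subtype.ext h.symm)), mul_zero]
  · simp

/-- A unitary matrix of `HankelSmall` symbols that is odd for a grading has index zero. -/
lemma exists_card_eq_of_hankelSmall {A : Type*} (e : A → C(X, ℂ)) (dep : A → ℕ)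
    (he : ∀ a b, a ≠ b → inner ℂ (T (e a)) (T (e b)) = 0) (he0 : ∀ a, T (e a) ≠ 0)
    (hadj : ∀ f g h, inner ℂ (T f) (T (g * h)) = inner ℂ (T (star g * f)) (T h))
    (D : Matrix V V C(X, ℂ)) (hD : Dᴴ * D = 1)
    (hH : ∀ u v, HankelSmall T (fun K => Submodule.span ℂ (e '' {a | K ≤ dep a})) (D u v))
    (s : V → Prop) [DecidablePred s] (hs : ∀ u v, (s u ↔ s v) → D u v = 0) :
    ∃ K₀, ∀ F : V → Finset A, (∀ v, ∀ a ∈ F v, K₀ ≤ dep a) →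
      (∀ u v, ∀ a ∈ F v, ∀ b, b ∉ F u → inner ℂ (T (e b)) (T (D u v * e a)) = 0) →
      ∑ v with s v, (F v).card = ∑ v with ¬ s v, (F v).card := by
  obtain ⟨K₁, h₁⟩ := card_le_of_hankelSmall e dep he he0 hadj D hD hH s hs
  obtain ⟨K₂, h₂⟩ := card_le_of_hankelSmall e dep he he0 hadj D hD hH (fun v => ¬ s v)
    (fun u v h => hs u v (not_iff_not.1 h))
  refine ⟨max K₁ K₂, fun F hF hc => le_antisymm
    (h₁ F (fun v a ha => (le_max_left _ _).trans (hF v a ha)) hc) ?_⟩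
  have := h₂ F (fun v a ha => (le_max_right _ _).trans (hF v a ha)) hc
  simpa only [not_not] using this

end Index

lemma sum_range_choose_succ_mul (M : ℕ) (φ : ℕ → ℤ) :
    ∑ i ∈ Finset.range (M + 2), ((M + 1).choose i : ℤ) * φ i =
      ∑ i ∈ Finset.range (M + 1), (M.choose i : ℤ) * (φ i + φ (i + 1)) := by
  rw [Finset.sum_range_succ']
  simp only [Nat.choose_succ_succ, Nat.cast_add, add_mul, mul_add, Finset.sum_add_distrib]
  have h : ∑ i ∈ Finset.range (M + 1), (M.choose (i + 1) : ℤ) * φ (i + 1) + M.choose 0 * φ 0 =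
      ∑ i ∈ Finset.range (M + 1), (M.choose i : ℤ) * φ i := by
    rw [← Finset.sum_range_succ' (fun i => (M.choose i : ℤ) * φ i), Finset.sum_range_succ]
    simp
  rw [← h]
  simp only [Nat.choose_zero_right]
  ring

/-- The Clifford (Koszul) matrix: a graded self-adjoint matrix with entries `± y i`, `± star (y i)`
whose square is the scalar matrix `∑ i, y i * star (y i)`. -/
lemma exists_clifford_matrix {R : Type*} [CommRing R] [StarRing R] (M : ℕ) (y : Fin M → R) :
    ∃ (V : Type) (_ : Fintype V) (_ : DecidableEq V) (deg : V → ℕ) (D : Matrix V V R),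
      Dᴴ = D ∧ D * D = (∑ i, y i * star (y i)) • (1 : Matrix V V R) ∧
      (∀ u v, D u v = 0 ∨ (deg u = deg v + 1 ∧ ∃ i, D u v = y i ∨ D u v = -y i) ∨
        (deg v = deg u + 1 ∧ ∃ i, D u v = star (y i) ∨ D u v = -star (y i))) ∧
      (∀ v, deg v ≤ M) ∧
      ∀ φ : ℕ → ℤ, ∑ v, φ (deg v) = ∑ i ∈ Finset.range (M + 1), (M.choose i : ℤ) * φ i := by
  induction M with
  | zero =>
    refine ⟨Unit, inferInstance, inferInstance, fun _ => 0, 0, ?_, ?_, ?_, ?_, ?_⟩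
    · simp
    · simp
    · intro u v; exact Or.inl rfl
    · simp
    · simp
  | succ M ih =>
    obtain ⟨V, _, _, deg, D, h1, h2, h3, h4, h5⟩ := ih (fun i => y i.castSucc)
    refine ⟨V ⊕ V, inferInstance, inferInstance, Sum.elim deg (fun v => deg v + 1),
      fromBlocks D (star (y (Fin.last M)) • 1) (y (Fin.last M) • 1) (-D), ?_, ?_, ?_, ?_, ?_⟩
    · rw [fromBlocks_conjTranspose, conjTranspose_smul, conjTranspose_smul, conjTranspose_neg, h1]
      simp
    · rw [fromBlocks_multiply, Fin.sum_univ_castSucc, ← fromBlocks_one, fromBlocks_smul]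
      simp only [smul_mul_assoc, mul_smul_comm, mul_one, one_mul, mul_neg, neg_mul, neg_neg,
        smul_neg, h2, smul_zero, smul_smul, add_neg_cancel, add_smul]
      congr 1
      rw [add_comm, mul_comm (star _)]
    · rintro (u | u) (v | v)
      · rcases h3 u v with h | ⟨h, i, hi⟩ | ⟨h, i, hi⟩
        · exact Or.inl h
        · exact Or.inr (Or.inl ⟨h, i.castSucc, hi⟩)
        · exact Or.inr (Or.inr ⟨h, i.castSucc, hi⟩)
      · by_cases huv : u = v
        · subst huv
          refine Or.inr (Or.inr ⟨rfl, Fin.last M, Or.inl ?_⟩)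
          simp
        · left; simp [huv]
      · by_cases huv : u = v
        · subst huv
          refine Or.inr (Or.inl ⟨rfl, Fin.last M, Or.inl ?_⟩)
          simp
        · left; simp [huv]
      · rcases h3 u v with h | ⟨h, i, hi⟩ | ⟨h, i, hi⟩
        · left; simp [h]
        · refine Or.inr (Or.inl ⟨by simp [h], i.castSucc, ?_⟩)
          rcases hi with hi | hi <;> simp [hi]
        · refine Or.inr (Or.inr ⟨by simp [h], i.castSucc, ?_⟩)
          rcases hi with hi | hi <;> simp [hi]
    · rintro (v | v)
      · exact (h4 v).trans (Nat.le_succ M)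
      · exact Nat.succ_le_succ (h4 v)
    · intro φ
      rw [Fintype.sum_sum_type, sum_range_choose_succ_mul]
      simp only [Sum.elim_inl, Sum.elim_inr]
      rw [h5, h5 (fun n => φ (n + 1)), ← Finset.sum_add_distrib]
      simp only [mul_add]

lemma exists_sub_pow_mul_sum_multichoose {R : Type*} [CommRing R] (u b : R) (l n : ℕ) :
    ∃ c, (u - b) ^ l * ∑ q ∈ Finset.range (n + 1), (l.multichoose q : R) * b ^ q * u ^ (n - q) =
      u ^ (l + n) + b ^ (n + 1) * c := by
  induction l with
  | zero =>
    refine ⟨0, ?_⟩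
    rw [Finset.sum_range_succ', Finset.sum_eq_zero]
    · simp
    · intro q _; simp
  | succ l ih =>
    obtain ⟨c, hc⟩ := ih
    have key : ∀ k ≤ n, (u - b) * ∑ q ∈ Finset.range (k + 1),
        ((l + 1).multichoose q : R) * b ^ q * u ^ (n - q) =
        u * ∑ q ∈ Finset.range (k + 1), (l.multichoose q : R) * b ^ q * u ^ (n - q) -
          (l + 1).multichoose k * b ^ (k + 1) * u ^ (n - k) := by
      intro k hk
      induction k with
      | zero => simp; ring
      | succ k ihk =>
        rw [Finset.sum_range_succ, mul_add, ihk (by omega), Finset.sum_range_succ _ (k + 1),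
          Nat.multichoose_succ_succ, show n - k = n - (k + 1) + 1 by omega]
        push_cast
        ring
    refine ⟨u * c - (u - b) ^ l * (l + 1).multichoose n, ?_⟩
    rw [pow_succ, mul_assoc, key n le_rfl, mul_sub, mul_left_comm, hc, Nat.sub_self]
    ring

lemma one_sub_C_mul_X_pow_mul_mk_multichoose {R : Type*} [CommRing R] (c : R) (l : ℕ) :
    (1 - PowerSeries.C c * PowerSeries.X) ^ l *
      PowerSeries.mk (fun q => (l.multichoose q : R) * c ^ q) = 1 := by
  induction l with
  | zero =>
    ext n
    cases n <;> simp
  | succ l ih =>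
    have : (1 - PowerSeries.C c * PowerSeries.X) *
        PowerSeries.mk (fun q => ((l + 1).multichoose q : R) * c ^ q) =
        PowerSeries.mk (fun q => (l.multichoose q : R) * c ^ q) := by
      ext n
      rw [sub_mul, one_mul, map_sub, mul_assoc, PowerSeries.coeff_C_mul]
      cases n with
      | zero => simp
      | succ n =>
        rw [PowerSeries.coeff_succ_X_mul]
        simp only [PowerSeries.coeff_mk, Nat.multichoose_succ_succ]
        push_cast
        ring
    rw [pow_succ, mul_assoc, this, ih]

open Polynomial in
lemma one_sub_X_pow_dvd_of_coeff_eq_zero {R : Type*} [CommRing R] (P : R[X]) (N K₀ : ℕ)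
    (h : ∀ K, K₀ ≤ K →
      PowerSeries.coeff K ((P : PowerSeries R) * PowerSeries.mk fun q => (N.multichoose q : R)) = 0) :
    (1 - X) ^ N ∣ P := by
  set φ := (P : PowerSeries R) * PowerSeries.mk fun q => (N.multichoose q : R) with hφ
  have h1 : ((PowerSeries.trunc K₀ φ : R[X]) : PowerSeries R) = φ := by
    ext n
    rw [Polynomial.coeff_coe, PowerSeries.coeff_trunc]
    split_ifs with hn
    · rfl
    · exact (h n (not_lt.1 hn)).symm
  refine ⟨PowerSeries.trunc K₀ φ, Polynomial.coe_injective R ?_⟩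
  have h2 := one_sub_C_mul_X_pow_mul_mk_multichoose (1 : R) N
  simp only [map_one, one_mul, one_pow, mul_one] at h2
  rw [Polynomial.coe_mul, h1, hφ, Polynomial.coe_pow, Polynomial.coe_sub, Polynomial.coe_one,
    Polynomial.coe_X, mul_left_comm, h2, mul_one]

lemma exists_generating_function_expansion {R : Type*} [CommRing R] (s τ G₁ G₂ v : R) (r l : ℕ)
    (hv : (1 - s * τ) ^ 2 * v = 1) (hG₁ : (1 - s) ^ l * G₁ = 1)
    (hG₂ : (1 - s * τ ^ 2) ^ l * G₂ = 1) :
    ∃ c, (1 - s * τ) ^ (2 * (r + l)) * (G₁ * G₂) =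
      ∑ q ∈ Finset.range (r + 1),
        (l.multichoose q : R) * (s * (1 - τ) ^ 2) ^ q * ((1 - s * τ) ^ 2) ^ (r - q) +
      (l.multichoose (r + 1) : R) * (s * (1 - τ) ^ 2) ^ (r + 1) * v +
      (s * (1 - τ) ^ 2) ^ (r + 2) * c := by
  obtain ⟨u, hu⟩ : ∃ u, u = (1 - s * τ) ^ 2 := ⟨_, rfl⟩
  obtain ⟨b, hb⟩ : ∃ b, b = s * (1 - τ) ^ 2 := ⟨_, rfl⟩
  have hub : (u - b) ^ l * (G₁ * G₂) = 1 := by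
    have : u - b = (1 - s) * (1 - s * τ ^ 2) := by rw [hu, hb]; ring
    rw [this, mul_pow, mul_mul_mul_comm, hG₁, hG₂, mul_one]
  rw [← hu] at hv
  rw [pow_mul, ← hu, ← hb]
  obtain ⟨c, hc⟩ := exists_sub_pow_mul_sum_multichoose u b l (r + 1)
  have h1 : (∑ q ∈ Finset.range (r + 1 + 1),
      (l.multichoose q : R) * b ^ q * u ^ (r + 1 - q)) * v =
      ∑ q ∈ Finset.range (r + 1), (l.multichoose q : R) * b ^ q * u ^ (r - q) +
      (l.multichoose (r + 1) : R) * b ^ (r + 1) * v := by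
    rw [Finset.sum_range_succ, add_mul, Nat.sub_self, pow_zero, mul_one]
    congr 1
    rw [Finset.sum_mul]
    refine Finset.sum_congr rfl fun q hq => ?_
    have : q ≤ r := by simpa [Nat.lt_succ_iff] using hq
    rw [Nat.succ_sub this, pow_succ, ← mul_assoc, mul_assoc, hv, mul_one]
  have h2 : u ^ (l + (r + 1)) * v = u ^ (r + l) := by
    rw [← add_assoc, pow_succ, mul_assoc, hv, mul_one, add_comm l r]
  rw [← h1, ← h2]
  generalize ∑ q ∈ Finset.range (r + 1 + 1),
    (l.multichoose q : R) * b ^ q * u ^ (r + 1 - q) = S at hc ⊢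
  refine ⟨-(c * v * (G₁ * G₂)), ?_⟩
  linear_combination S * v * hub - v * (G₁ * G₂) * hc

/-- The number of monomials of a given bidegree. -/
def bidegreeCount (l N j k : ℕ) : ℤ :=
  ∑ p ∈ Finset.HasAntidiagonal.antidiagonal j,
    (l.multichoose p.1 : ℤ) * l.multichoose p.2 * N.multichoose (k + p.1 - p.2)

open Polynomial in
lemma alternating_sum_bidegreeCount_ne_zero (r l j k₀ : ℕ) (hl : 1 ≤ l) :
    ∃ k, k₀ ≤ k ∧ ∑ i ∈ Finset.range (2 * (r + l) + 1),
      ((2 * (r + l)).choose i : ℤ) * ((-1) ^ i * bidegreeCount l (2 * r + 3) (j + i) k) ≠ 0 := by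
  by_contra! hcon
  set m := r + l with hm
  set N := 2 * r + 3 with hN
  let g : ℕ → ℤ[X] := fun j => ∑ p ∈ Finset.HasAntidiagonal.antidiagonal j,
    C ((l.multichoose p.1 : ℤ) * l.multichoose p.2) * X ^ (2 * p.2)
  let P : ℤ[X] := ∑ i ∈ Finset.range (2 * m + 1),
    C (((2 * m).choose i : ℤ) * (-1) ^ i) * (X ^ (2 * m - i) * g (j + i))
  -- The generating function of the counts has a polynomial tail.
  have hdvd : (1 - X) ^ N ∣ P := by
    refine one_sub_X_pow_dvd_of_coeff_eq_zero P N (k₀ + 2 * j + 4 * m) fun K hK => ?_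
    obtain ⟨k, rfl⟩ : ∃ k, K = k + j + 2 * m := ⟨K - j - 2 * m, by omega⟩
    rw [← hcon k (by omega)]
    have hP : (P : PowerSeries ℤ) = ∑ i ∈ Finset.range (2 * m + 1),
        PowerSeries.C (((2 * m).choose i : ℤ) * (-1) ^ i) *
          ∑ p ∈ Finset.HasAntidiagonal.antidiagonal (j + i),
            PowerSeries.C ((l.multichoose p.1 : ℤ) * l.multichoose p.2) *
              PowerSeries.X ^ (2 * m - i + 2 * p.2) := by
      rw [← Polynomial.coeToPowerSeries.ringHom_apply]
      simp only [P, g, map_sum, map_mul, map_pow, Polynomial.coeToPowerSeries.ringHom_apply,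
        Polynomial.coe_C, Polynomial.coe_X, Finset.mul_sum]
      refine Finset.sum_congr rfl fun i _ => Finset.sum_congr rfl fun p _ => ?_
      ring
    rw [hP, Finset.sum_mul, map_sum]
    refine Finset.sum_congr rfl fun i hi => ?_
    have hi' : i ≤ 2 * m := by simpa [Nat.lt_succ_iff] using hi
    rw [mul_assoc, PowerSeries.coeff_C_mul, mul_assoc]
    congr 2
    rw [Finset.sum_mul, map_sum, bidegreeCount]
    refine Finset.sum_congr rfl fun p hp => ?_
    have hp' := Finset.HasAntidiagonal.mem_antidiagonal.1 hp
    rw [mul_assoc, PowerSeries.coeff_C_mul, PowerSeries.coeff_X_pow_mul', if_pos (by omega),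
      PowerSeries.coeff_mk]
    congr 3
    omega
  let s : PowerSeries ℤ[X] := PowerSeries.X
  let τ : PowerSeries ℤ[X] := PowerSeries.C X
  let G₁ : PowerSeries ℤ[X] := PowerSeries.mk fun q => (l.multichoose q : ℤ[X])
  let G₂ : PowerSeries ℤ[X] := PowerSeries.mk fun q => (l.multichoose q : ℤ[X]) * (X ^ 2) ^ q
  let v : PowerSeries ℤ[X] := PowerSeries.mk fun q => (Nat.multichoose 2 q : ℤ[X]) * X ^ q
  have hv : (1 - s * τ) ^ 2 * v = 1 := by
    rw [mul_comm s]; exact one_sub_C_mul_X_pow_mul_mk_multichoose (X : ℤ[X]) 2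
  have hG₁ : (1 - s) ^ l * G₁ = 1 := by
    have := one_sub_C_mul_X_pow_mul_mk_multichoose (1 : ℤ[X]) l
    simpa using this
  have hG₂ : (1 - s * τ ^ 2) ^ l * G₂ = 1 := by
    have := one_sub_C_mul_X_pow_mul_mk_multichoose (X ^ 2 : ℤ[X]) l
    rwa [map_pow, mul_comm _ PowerSeries.X] at this
  have hP : PowerSeries.coeff (j + 2 * m) ((1 - s * τ) ^ (2 * m) * (G₁ * G₂)) = P := by
    have h1 : (1 - s * τ) ^ (2 * m) = ∑ i ∈ Finset.range (2 * m + 1),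
        PowerSeries.C (C (((2 * m).choose i : ℤ) * (-1) ^ i) * X ^ (2 * m - i)) *
          s ^ (2 * m - i) := by
      rw [sub_eq_add_neg, add_pow]
      refine Finset.sum_congr rfl fun i hi => ?_
      have hi' : i ≤ 2 * m := by simpa [Nat.lt_succ_iff] using hi
      have hsgn : (-1 : ℤ) ^ (2 * m - i) = (-1) ^ i := by
        rw [neg_one_pow_eq_pow_mod_two, neg_one_pow_eq_pow_mod_two (n := i)]
        congr 1; omega
      rw [neg_pow, ← hsgn]
      simp only [map_mul, map_pow, map_neg, map_one, map_natCast, τ]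
      ring
    rw [h1, Finset.sum_mul, map_sum]
    refine Finset.sum_congr rfl fun i hi => ?_
    have hi' : i ≤ 2 * m := by simpa [Nat.lt_succ_iff] using hi
    rw [mul_assoc, PowerSeries.coeff_C_mul, PowerSeries.coeff_X_pow_mul', if_pos (by omega),
      show j + 2 * m - (2 * m - i) = j + i by omega, PowerSeries.coeff_mul, mul_assoc]
    congr 2
    refine Finset.sum_congr rfl fun p _ => ?_
    simp only [G₁, G₂, PowerSeries.coeff_mk, pow_mul, map_mul, map_natCast]
    ring
  obtain ⟨c, hW⟩ := exists_generating_function_expansion s τ G₁ G₂ v r l hv hG₁ hG₂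
  set u := (1 - s * τ) ^ 2
  set b := s * (1 - τ) ^ 2
  have hbC : ∀ q, b ^ q = PowerSeries.X ^ q * PowerSeries.C ((1 - X) ^ (2 * q)) := by
    intro q
    simp only [b, s, τ, mul_pow, map_pow, map_sub, map_one, ← pow_mul]
  have hpoly : ∀ q, q ≤ r → PowerSeries.coeff (j + 2 * m)
      ((l.multichoose q : PowerSeries ℤ[X]) * b ^ q * u ^ (r - q)) = 0 := by
    intro q hq
    let p : (ℤ[X])[X] := (l.multichoose q : (ℤ[X])[X]) * (X * (1 - C X) ^ 2) ^ q *
      ((1 - X * C X) ^ 2) ^ (r - q)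
    have hp : (l.multichoose q : PowerSeries ℤ[X]) * b ^ q * u ^ (r - q) = (p : PowerSeries ℤ[X]) := by
      rw [← Polynomial.coeToPowerSeries.ringHom_apply]
      simp only [p, map_mul, map_pow, map_sub, map_one, map_natCast]
      simp only [Polynomial.coeToPowerSeries.ringHom_apply, Polynomial.coe_C, Polynomial.coe_X]
      rfl
    rw [hp, Polynomial.coeff_coe]
    refine Polynomial.coeff_eq_zero_of_natDegree_lt ?_
    have hdeg : p.natDegree ≤ 0 + q * 1 + (r - q) * (2 * 1) := by
      refine Polynomial.natDegree_mul_le_of_le (Polynomial.natDegree_mul_le_of_le ?_ ?_) ?_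
      · rw [Polynomial.natDegree_natCast]
      · refine Polynomial.natDegree_pow_le_of_le q ?_
        compute_degree
      · refine Polynomial.natDegree_pow_le_of_le _ (Polynomial.natDegree_pow_le_of_le 2 ?_)
        compute_degree
    omega
  rw [← hm] at hW
  rw [hW, map_add, map_add, map_sum, Finset.sum_eq_zero (fun q hq => hpoly q (by
    simpa [Nat.lt_succ_iff] using hq)), zero_add] at hP
  have hlast : (1 - X : ℤ[X]) ^ N ∣ PowerSeries.coeff (j + 2 * m)
      (b ^ (r + 2) * c) := by
    rw [hbC, mul_comm (PowerSeries.X ^ _), mul_assoc, PowerSeries.coeff_C_mul]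
    exact Dvd.dvd.mul_right (pow_dvd_pow _ (by omega)) _
  rw [← eq_sub_iff_add_eq] at hP
  have hd : (1 - X : ℤ[X]) ^ N ∣ PowerSeries.coeff (j + 2 * m)
      ((l.multichoose (r + 1) : PowerSeries ℤ[X]) * b ^ (r + 1) * v) := by
    rw [hP]; exact dvd_sub hdvd hlast
  have hco : PowerSeries.coeff (j + 2 * m)
      ((l.multichoose (r + 1) : PowerSeries ℤ[X]) * b ^ (r + 1) * v) =
      (1 - X : ℤ[X]) ^ (2 * (r + 1)) * ((l.multichoose (r + 1) : ℤ[X]) *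
        ((Nat.multichoose 2 (j + 2 * m - (r + 1)) : ℤ[X]) * X ^ (j + 2 * m - (r + 1)))) := by
    have : (l.multichoose (r + 1) : PowerSeries ℤ[X]) * b ^ (r + 1) * v =
        PowerSeries.C ((1 - X) ^ (2 * (r + 1)) * (l.multichoose (r + 1) : ℤ[X])) *
          (PowerSeries.X ^ (r + 1) * v) := by
      rw [hbC, map_mul, map_natCast]; ring
    rw [this, PowerSeries.coeff_C_mul, PowerSeries.coeff_X_pow_mul', if_pos (by omega),
      PowerSeries.coeff_mk, mul_assoc]
  have hne : (1 - X : ℤ[X]) ≠ 0 := by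
    intro h
    have := congrArg (Polynomial.eval 0) h
    simp at this
  rw [hco, show N = 2 * (r + 1) + 1 by omega, pow_succ,
    mul_dvd_mul_iff_left (pow_ne_zero _ hne)] at hd
  have h3 := Polynomial.eval_dvd (x := 1) hd
  simp only [eval_sub, eval_one, eval_X, sub_self, eval_mul, eval_natCast, eval_pow, one_pow,
    mul_one, zero_dvd_iff, mul_eq_zero, Nat.cast_eq_zero] at h3
  simp only [Nat.multichoose_eq, Nat.choose_eq_zero_iff] at h3
  omega

section SphereProduct

open MeasureTheory Metric

variable (ι κ : Type) [Fintype ι] [Fintype κ]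

/-- The product of two complex unit spheres. -/
abbrev SphereProd : Type :=
  sphere (0 : EuclideanSpace ℂ ι) 1 × sphere (0 : EuclideanSpace ℂ κ) 1

variable {ι κ}

/-- The complex coordinates on a product of two spheres. -/
noncomputable def SphereProd.coord : ι ⊕ κ → C(SphereProd ι κ, ℂ) :=
  Sum.elim (fun i => ⟨fun x => x.1.1 i, by fun_prop⟩) (fun j => ⟨fun x => x.2.1 j, by fun_prop⟩)

/-- The monomial functions on a product of two spheres. -/
noncomputable def SphereProd.mon (a : ι ⊕ κ → ℕ) : C(SphereProd ι κ, ℂ) := ∏ i, SphereProd.coord i ^ a i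

open SphereProd

/-- The smaller of the two degrees of a bihomogeneous monomial. -/
def minDegree (a : ι ⊕ κ → ℕ) : ℕ := min (∑ i, a (Sum.inl i)) (∑ j, a (Sum.inr j))

lemma factorial_moment_recurrence {ι : Type} [Fintype ι] [DecidableEq ι] [Nonempty ι] (α : ι → ℕ)
    (i : ι) :
    (∏ k, (((α + Pi.single i 1 : ι → ℕ) k).factorial : ℝ)) /
        ((∑ k, (α + Pi.single i 1 : ι → ℕ) k) + (Fintype.card ι - 1)).factorial *
        ((∑ k, α k) + (Fintype.card ι - 1) + 1 : ℕ) =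
      (α i + 1) * ((∏ k, ((α k).factorial : ℝ)) /
        ((∑ k, α k) + (Fintype.card ι - 1)).factorial) := by
  have h1 : ∏ k, (((α + Pi.single i 1 : ι → ℕ) k).factorial : ℝ) =
      (α i + 1) * ∏ k, ((α k).factorial : ℝ) := by
    rw [← Finset.mul_prod_erase _ _ (Finset.mem_univ i),
      ← Finset.mul_prod_erase _ (fun k => ((α k).factorial : ℝ)) (Finset.mem_univ i), ← mul_assoc]
    congr 1
    · simp [Nat.factorial_succ]
    · refine Finset.prod_congr rfl fun k hk => ?_
      simp [Finset.ne_of_mem_erase hk]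
  have h2 : ∑ k, (α + Pi.single i 1 : ι → ℕ) k = ∑ k, α k + 1 := by
    simp [Finset.sum_add_distrib]
  rw [h1, h2, show ∑ k, α k + 1 + (Fintype.card ι - 1) = ∑ k, α k + (Fintype.card ι - 1) + 1 by ring,
    Nat.factorial_succ]
  push_cast
  have : ((∑ k, α k + (Fintype.card ι - 1)).factorial : ℝ) ≠ 0 := by positivity
  field_simp

/-- A torus-invariant measure on a product of two spheres, with its moments. -/
lemma exists_sphereProd_measure (ι κ : Type) [Fintype ι] [Fintype κ] [Nonempty ι] [Nonempty κ]
    [DecidableEq ι] [DecidableEq κ] :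
    ∃ μ : Measure (SphereProd ι κ), IsFiniteMeasure μ ∧
      (∀ t : ι ⊕ κ → ℂ, (∀ i, ‖t i‖ = 1) → ∃ g : C(SphereProd ι κ, SphereProd ι κ),
        MeasurePreserving g μ μ ∧ ∀ x i, coord i (g x) = t i * coord i x) ∧
      ∃ (I : (ι ⊕ κ → ℕ) → ℝ) (d : ι ⊕ κ → (ι ⊕ κ → ℕ) → ℕ), (∀ a, 0 < I a) ∧
        (∀ a, ∫ x, ∏ i, ‖coord i x‖ ^ (2 * a i) ∂μ = I a) ∧
        (∀ i a, I (a + Pi.single i 1) * (d i a + 1 : ℕ) = (a i + 1) * I a) ∧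
        (∀ i a, d i (a + Pi.single i 1) = d i a + 1) ∧ ∀ i a, minDegree a ≤ d i a := by
  obtain ⟨μ₁, _, inv₁, C₁, hC₁, hI₁⟩ := exists_sphere_measure ι
  obtain ⟨μ₂, _, inv₂, C₂, hC₂, hI₂⟩ := exists_sphere_measure κ
  have hrot : ∀ {ι : Type} [Fintype ι] (t : ι → ℂ), (∀ i, ‖t i‖ = 1) →
      ∃ g : C(sphere (0 : EuclideanSpace ℂ ι) 1, sphere (0 : EuclideanSpace ℂ ι) 1),
        ∀ x i, (g x).1 i = t i * x.1 i := by
    intro ι _ t ht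
    refine ⟨⟨fun x => ⟨WithLp.toLp 2 fun i => t i * x.1 i, ?_⟩, ?_⟩, fun x i => rfl⟩
    · have hx := x.2
      rw [mem_sphere_zero_iff_norm, EuclideanSpace.norm_eq] at hx ⊢
      simpa [ht] using hx
    · fun_prop
  refine ⟨μ₁.prod μ₂, inferInstance, ?_, ?_⟩
  · intro t ht
    obtain ⟨g₁, h₁⟩ := hrot (fun i => t (Sum.inl i)) (fun i => ht _)
    obtain ⟨g₂, h₂⟩ := hrot (fun i => t (Sum.inr i)) (fun i => ht _)
    refine ⟨⟨fun x => (g₁ x.1, g₂ x.2), by fun_prop⟩, ?_, ?_⟩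
    · exact (inv₁ _ (fun i => ht _) g₁ h₁).prod (inv₂ _ (fun i => ht _) g₂ h₂)
    · rintro x (i | i)
      · exact h₁ x.1 i
      · exact h₂ x.2 i
  let J₁ : (ι → ℕ) → ℝ := fun α => (∏ k, ((α k).factorial : ℝ)) /
    ((∑ k, α k) + (Fintype.card ι - 1)).factorial
  let J₂ : (κ → ℕ) → ℝ := fun α => (∏ k, ((α k).factorial : ℝ)) /
    ((∑ k, α k) + (Fintype.card κ - 1)).factorial
  refine ⟨fun a => C₁ * C₂ * J₁ (fun i => a (Sum.inl i)) * J₂ (fun i => a (Sum.inr i)),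
    Sum.elim (fun _ a => (∑ i, a (Sum.inl i)) + (Fintype.card ι - 1))
      (fun _ a => (∑ i, a (Sum.inr i)) + (Fintype.card κ - 1)), ?_, ?_, ?_, ?_, ?_⟩
  · intro a
    have : 0 < J₁ (fun i => a (Sum.inl i)) := by simp only [J₁]; positivity
    have : 0 < J₂ (fun i => a (Sum.inr i)) := by simp only [J₂]; positivity
    positivity
  · intro a
    simp only [Fintype.prod_sum_type]
    have := integral_prod_mul (μ := μ₁) (ν := μ₂)
      (fun x : sphere (0 : EuclideanSpace ℂ ι) 1 => ∏ i, ‖x.1 i‖ ^ (2 * a (Sum.inl i)))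
      (fun x : sphere (0 : EuclideanSpace ℂ κ) 1 => ∏ i, ‖x.1 i‖ ^ (2 * a (Sum.inr i)))
    rw [hI₁, hI₂] at this
    refine this.trans ?_
    simp only [J₁, J₂]
    ring
  · rintro (i | i) a
    · have h := factorial_moment_recurrence (fun i => a (Sum.inl i)) i
      have e1 : (fun k => (a + Pi.single (Sum.inl i) 1 : ι ⊕ κ → ℕ) (Sum.inl k)) =
          (fun i => a (Sum.inl i)) + Pi.single i 1 := by
        ext k; simp [Pi.single_apply]
      have e2 : (fun k => (a + Pi.single (Sum.inl i) 1 : ι ⊕ κ → ℕ) (Sum.inr k)) = fun k => a (Sum.inr k) := by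
        ext k; simp
      simp only [e1, e2, Sum.elim_inl]
      simp only [J₁, J₂] at h ⊢
      linear_combination C₁ * C₂ * J₂ (fun i => a (Sum.inr i)) * h
    · have h := factorial_moment_recurrence (fun i => a (Sum.inr i)) i
      have e1 : (fun k => (a + Pi.single (Sum.inr i) 1 : ι ⊕ κ → ℕ) (Sum.inr k)) =
          (fun i => a (Sum.inr i)) + Pi.single i 1 := by
        ext k; simp [Pi.single_apply]
      have e2 : (fun k => (a + Pi.single (Sum.inr i) 1 : ι ⊕ κ → ℕ) (Sum.inl k)) = fun k => a (Sum.inl k) := by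
        ext k; simp
      simp only [e1, e2, Sum.elim_inr]
      simp only [J₁, J₂] at h ⊢
      linear_combination C₁ * C₂ * J₁ (fun i => a (Sum.inl i)) * h
  · rintro (i | i) a
    · simp [Finset.sum_add_distrib, Pi.single_apply]; ring
    · simp [Finset.sum_add_distrib, Pi.single_apply]; ring
  · rintro (i | i) a
    · exact (min_le_left _ _).trans (Nat.le_add_right _ _)
    · exact (min_le_right _ _).trans (Nat.le_add_right _ _)

end SphereProduct

section ToL2

open MeasureTheory

variable {X : Type*} [TopologicalSpace X] [CompactSpace X] [MeasurableSpace X] [BorelSpace X]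

/-- The inclusion of continuous functions in `L²`. -/
noncomputable def toL2 (μ : Measure X) [IsFiniteMeasure μ] : C(X, ℂ) →ₗ[ℂ] Lp ℂ 2 μ :=
  (ContinuousMap.toLp 2 μ ℂ).toLinearMap

variable (μ : Measure X) [IsFiniteMeasure μ]

lemma inner_toL2 (f g : C(X, ℂ)) :
    inner ℂ (toL2 μ f) (toL2 μ g) = ∫ x, g x * star (f x) ∂μ :=
  ContinuousMap.inner_toLp μ f g

lemma norm_toL2_mul_le (f g : C(X, ℂ)) : ‖toL2 μ (f * g)‖ ≤ ‖f‖ * ‖toL2 μ g‖ := by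
  refine Lp.norm_le_mul_norm_of_ae_le_mul ?_
  filter_upwards [ContinuousMap.coeFn_toLp (p := 2) (𝕜 := ℂ) μ (f * g),
    ContinuousMap.coeFn_toLp (p := 2) (𝕜 := ℂ) μ g] with x h1 h2
  change ‖(ContinuousMap.toLp 2 μ ℂ (f * g)) x‖ ≤ ‖f‖ * ‖(ContinuousMap.toLp 2 μ ℂ g) x‖
  rw [h1, h2, ContinuousMap.mul_apply, norm_mul]
  gcongr
  exact f.norm_coe_le_norm x

lemma inner_toL2_mul_right (f g h : C(X, ℂ)) :
    inner ℂ (toL2 μ f) (toL2 μ (g * h)) = inner ℂ (toL2 μ (star g * f)) (toL2 μ h) := by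
  rw [inner_toL2, inner_toL2]
  refine integral_congr_ae (.of_forall fun x => ?_)
  simp only [ContinuousMap.mul_apply, ContinuousMap.star_apply, star_mul', star_star]
  ring

/-- Eigenfunctions of a measure-preserving map with different eigenvalues are orthogonal. -/
lemma inner_toL2_eq_zero {g : C(X, X)} (hg : MeasurePreserving g μ μ) {f₁ f₂ : C(X, ℂ)}
    {c₁ c₂ : ℂ} (h₁ : ∀ x, f₁ (g x) = c₁ * f₁ x) (h₂ : ∀ x, f₂ (g x) = c₂ * f₂ x)
    (hc₁ : ‖c₁‖ = 1) (hne : c₁ ≠ c₂) : inner ℂ (toL2 μ f₁) (toL2 μ f₂) = 0 := by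
  rw [inner_toL2]
  set F : X → ℂ := fun x => f₂ x * star (f₁ x) with hF
  have hFc : Continuous F := by fun_prop
  have h3 : ∫ x, F (g x) ∂μ = ∫ x, F x ∂μ := by
    conv_rhs => rw [← hg.map_eq]
    exact (integral_map hg.measurable.aemeasurable hFc.aestronglyMeasurable).symm
  have h4 : ∀ x, F (g x) = (c₂ * star c₁) * F x := fun x => by
    simp only [hF, h₁, h₂, star_mul']; ring
  simp only [h4, integral_const_mul] at h3
  have h5 : c₁ * star c₁ = 1 := by
    have := RCLike.mul_conj c₁
    rw [hc₁] at this
    simpa using this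
  by_contra h0
  have h6 : c₂ * star c₁ = 1 := mul_right_cancel₀ h0 (h3.trans (one_mul _).symm)
  have h7 : star c₁ ≠ 0 := fun h => by simp [h] at h5
  exact hne (mul_right_cancel₀ h7 (h5.trans h6.symm))

lemma norm_toL2_sq (f : C(X, ℂ)) : ((‖toL2 μ f‖ ^ 2 : ℝ) : ℂ) = ∫ x, f x * star (f x) ∂μ := by
  rw [← inner_toL2, inner_self_eq_norm_sq_to_K, Complex.ofReal_pow]; rfl

end ToL2

lemma exists_norm_eq_one_pow_ne {p q : ℕ} (h : p ≠ q) : ∃ c : ℂ, ‖c‖ = 1 ∧ c ^ p ≠ c ^ q := by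
  have hp := Complex.isPrimitiveRoot_exp (p + q + 1) (by omega)
  refine ⟨_, hp.norm'_eq_one (by omega), fun hc => h (hp.pow_inj (by omega) (by omega) hc)⟩

section SphereProduct

open MeasureTheory SphereProd

variable {ι κ : Type} [Fintype ι] [Fintype κ]

lemma SphereProd.mon_apply (a : ι ⊕ κ → ℕ) (x : SphereProd ι κ) :
    mon a x = ∏ i, coord i x ^ a i := by
  simp [mon, ContinuousMap.prod_apply]

lemma SphereProd.coord_mul_mon [DecidableEq ι] [DecidableEq κ] (i : ι ⊕ κ) (a : ι ⊕ κ → ℕ) :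
    coord i * mon a = mon (a + Pi.single i 1) := by
  simp only [mon, Pi.add_apply, pow_add, Finset.prod_mul_distrib]
  rw [mul_comm, Finset.prod_eq_single (f := fun k => coord k ^ (Pi.single i 1 : ι ⊕ κ → ℕ) k) i]
  · simp
  · intro k _ hk
    simp [hk]
  · simp

lemma SphereProd.mon_comp (t : ι ⊕ κ → ℂ) (g : C(SphereProd ι κ, SphereProd ι κ))
    (hg : ∀ x i, coord i (g x) = t i * coord i x) (a : ι ⊕ κ → ℕ) (x : SphereProd ι κ) :
    mon a (g x) = (∏ i, t i ^ a i) * mon a x := by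
  simp only [mon_apply, hg, mul_pow, Finset.prod_mul_distrib]

lemma SphereProd.coord_separates (x y : SphereProd ι κ) (h : ∀ i, coord i x = coord i y) :
    x = y := by
  refine Prod.ext (Subtype.ext ?_) (Subtype.ext ?_)
  · ext i; exact h (Sum.inl i)
  · ext i; exact h (Sum.inr i)

lemma minDegree_add_single [DecidableEq ι] [DecidableEq κ] (a : ι ⊕ κ → ℕ) (i : ι ⊕ κ) :
    minDegree a ≤ minDegree (a + Pi.single i 1) ∧
      minDegree (a + Pi.single i 1) ≤ minDegree a + 1 := by
  rcases i with i | i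
  · simp only [minDegree, Pi.add_apply, Finset.sum_add_distrib, Pi.single_apply,
      Sum.inl.injEq, reduceCtorEq, if_false, Finset.sum_ite_eq', Finset.mem_univ, if_true,
      Finset.sum_const_zero]
    omega
  · simp only [minDegree, Pi.add_apply, Finset.sum_add_distrib, Pi.single_apply,
      Sum.inr.injEq, reduceCtorEq, if_false, Finset.sum_ite_eq', Finset.mem_univ, if_true,
      Finset.sum_const_zero]
    omega

end SphereProduct

open MeasureTheory in
lemma norm_toL2_sq_eq_integral {X : Type*} [TopologicalSpace X] [CompactSpace X]
    [MeasurableSpace X] [BorelSpace X] (μ : Measure X) [IsFiniteMeasure μ] (f : C(X, ℂ)) :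
    ‖toL2 μ f‖ ^ 2 = ∫ x, ‖f x‖ ^ 2 ∂μ := by
  apply Complex.ofReal_injective
  rw [norm_toL2_sq, ← integral_complex_ofReal]
  refine integral_congr_ae (.of_forall fun x => ?_)
  have := RCLike.mul_conj (f x)
  simpa using this

section SphereProduct

open MeasureTheory SphereProd

variable {ι κ : Type} [DecidableEq ι] [DecidableEq κ]

lemma norm_update_one (k : ι ⊕ κ) {c : ℂ} (hc : ‖c‖ = 1) (i : ι ⊕ κ) :
    ‖(Function.update 1 k c : ι ⊕ κ → ℂ) i‖ = 1 := by
  by_cases h : i = k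
  · subst h; simpa using hc
  · simp [h]

variable [Fintype ι] [Fintype κ]

lemma prod_update_one_pow (k : ι ⊕ κ) (c : ℂ) (a : ι ⊕ κ → ℕ) :
    ∏ i, (Function.update 1 k c : ι ⊕ κ → ℂ) i ^ a i = c ^ a k := by
  rw [Finset.prod_eq_single k]
  · simp
  · intro i _ hi
    simp [hi]
  · simp

/-- Multiplication by a conjugate coordinate almost preserves the filtration of the space of
polynomials by the degree. -/
lemma hankelSmall_star_coord (μ : Measure (SphereProd ι κ)) [IsFiniteMeasure μ]
    (hinv : ∀ t : ι ⊕ κ → ℂ, (∀ i, ‖t i‖ = 1) → ∃ g : C(SphereProd ι κ, SphereProd ι κ),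
        MeasurePreserving g μ μ ∧ ∀ x i, coord i (g x) = t i * coord i x)
    (horth : ∀ a b : ι ⊕ κ → ℕ, a ≠ b → inner ℂ (toL2 μ (mon a)) (toL2 μ (mon b)) = 0)
    (I : (ι ⊕ κ → ℕ) → ℝ) (d : ι ⊕ κ → (ι ⊕ κ → ℕ) → ℕ) (hpos : ∀ a, 0 < I a)
    (hI : ∀ a, ∫ x, ‖mon a x‖ ^ 2 ∂μ = I a)
    (hrec : ∀ i a, I (a + Pi.single i 1) * (d i a + 1 : ℕ) = (a i + 1) * I a)
    (hd : ∀ i a, d i (a + Pi.single i 1) = d i a + 1) (hmin : ∀ i a, minDegree a ≤ d i a)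
    (i : ι ⊕ κ) :
    HankelSmall (toL2 μ) (fun K => Submodule.span ℂ (mon '' {a | K ≤ minDegree a}))
      (star (coord i)) := by
  let w : (ι ⊕ κ → ℕ) → C(SphereProd ι κ, ℂ) := fun a =>
    if a i = 0 then 0 else ((I a / I (a - Pi.single i 1) : ℝ) : ℂ) • mon (a - Pi.single i 1)
  have hw0 : ∀ a, a i = 0 → w a = 0 := fun a ha => if_pos ha
  have hw1 : ∀ b, w (b + Pi.single i 1) = ((I (b + Pi.single i 1) / I b : ℝ) : ℂ) • mon b := by
    intro b
    have : (b + Pi.single i 1 : ι ⊕ κ → ℕ) i ≠ 0 := by simp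
    simp only [w, if_neg this, add_tsub_cancel_right]
  have hcases : ∀ a : ι ⊕ κ → ℕ, a i = 0 ∨ ∃ b : ι ⊕ κ → ℕ, a = b + Pi.single i 1 := by
    intro a
    refine or_iff_not_imp_left.2 fun h => ⟨a - Pi.single i 1, (tsub_add_cancel_of_le ?_).symm⟩
    intro k
    by_cases hk : k = i
    · subst hk; simpa using Nat.one_le_iff_ne_zero.2 h
    · simp [hk]
  have hmonadd : ∀ (b : ι ⊕ κ → ℕ) x, mon (b + Pi.single i 1) x = coord i x * mon b x := by
    intro b x; rw [← coord_mul_mon]; rfl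
  refine hankelSmall_of_orthogonal mon minDegree horth (star (coord i)) w ?_ ?_ ?_
  · intro K'
    refine ⟨K' + 1, fun a ha => ?_⟩
    rcases hcases a with h | ⟨b, rfl⟩
    · rw [hw0 a h]; exact Submodule.zero_mem _
    · rw [hw1]
      refine Submodule.smul_mem _ _ (Submodule.subset_span ⟨b, ?_, rfl⟩)
      have := (minDegree_add_single b i).2
      change K' ≤ minDegree b
      omega
  · intro a b hab
    obtain ⟨k, hk⟩ := Function.ne_iff.1 hab
    obtain ⟨c, hc, hck⟩ := exists_norm_eq_one_pow_ne hk
    obtain ⟨g, hg, hgx⟩ := hinv (Function.update 1 k c) (norm_update_one k hc)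
    set t : ι ⊕ κ → ℂ := Function.update 1 k c
    have hti : star (t i) * t i = 1 := by
      have := RCLike.conj_mul (t i)
      rw [norm_update_one k hc] at this
      simpa using this
    have heig : ∀ a x, (star (coord i) * mon a - w a) (g x) =
        (star (t i) * c ^ a k) * (star (coord i) * mon a - w a) x := by
      intro a x
      rcases hcases a with h | ⟨b, rfl⟩
      · rw [hw0 a h]
        simp only [ContinuousMap.mul_apply, ContinuousMap.star_apply, hgx, mon_comp t g hgx, star_mul', sub_zero]
        rw [prod_update_one_pow]
        ring
      · have h1 : t i * (∏ j, t j ^ b j) = c ^ (b + Pi.single i 1 : ι ⊕ κ → ℕ) k := by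
          rw [← prod_update_one_pow k c]
          simp only [Pi.add_apply, pow_add, Finset.prod_mul_distrib]
          rw [mul_comm, Finset.prod_eq_single
            (f := fun j => (Function.update 1 k c : ι ⊕ κ → ℂ) j ^ (Pi.single i 1 : ι ⊕ κ → ℕ) j) i]
          · simp [t]
          · intro k _ hk
            simp [hk]
          · simp
        rw [hw1]
        simp only [ContinuousMap.sub_apply, ContinuousMap.mul_apply, ContinuousMap.star_apply,
          ContinuousMap.smul_apply, smul_eq_mul, hgx, hmonadd, mon_comp t g hgx, star_mul']
        rw [← h1]
        linear_combination ((I (b + Pi.single i 1) / I b : ℝ) : ℂ) * (∏ j, t j ^ b j) * mon b x *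
          hti
    refine inner_toL2_eq_zero μ hg (heig a) (heig b) ?_ ?_
    · rw [norm_mul, norm_star, norm_update_one k hc, norm_pow, hc, one_pow, one_mul]
    · intro h
      refine hck (mul_left_cancel₀ (a := star (t i)) ?_ h)
      intro h0
      rw [h0, zero_mul] at hti
      exact zero_ne_one hti
  · intro ε hε
    have hnorm : ∀ a, ‖toL2 μ (star (coord i) * mon a - w a)‖ ^ 2 ≤ I a / (d i a + 1) := by
      intro a
      rw [norm_toL2_sq_eq_integral]
      rcases hcases a with h | ⟨b, rfl⟩
      · rw [hw0 a h]
        have h1 : ∀ x, ‖(star (coord i) * mon a - 0) x‖ ^ 2 = ‖mon (a + Pi.single i 1) x‖ ^ 2 := by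
          intro x
          rw [hmonadd]
          simp
        simp only [h1, hI]
        have h2 := hrec i a
        rw [h] at h2
        rw [le_div_iff₀ (by positivity)]
        push_cast at h2
        linarith
      · rw [hw1]
        set b' := b + Pi.single i 1 with hb'
        set c := I b' / I b with hc
        have h1 : ∀ x, ‖(star (coord i) * mon b' - ((c : ℝ) : ℂ) • mon b) x‖ ^ 2 =
            ‖mon (b' + Pi.single i 1) x‖ ^ 2 - 2 * c * ‖mon b' x‖ ^ 2 + c ^ 2 * ‖mon b x‖ ^ 2 := by
          intro x
          rw [hmonadd b', hb', hmonadd b]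
          simp only [ContinuousMap.sub_apply, ContinuousMap.mul_apply, ContinuousMap.star_apply,
            ContinuousMap.smul_apply, smul_eq_mul, hmonadd b]
          have h2 : star (coord i x) * (coord i x * mon b x) - (c : ℂ) * mon b x =
              ((‖coord i x‖ ^ 2 - c : ℝ) : ℂ) * mon b x := by
            have := RCLike.conj_mul (coord i x)
            push_cast
            rw [← mul_assoc, show star (coord i x) * coord i x = (‖coord i x‖ : ℂ) ^ 2 from this]
            ring
          rw [h2]
          simp only [norm_mul, mul_pow, Complex.norm_real, Real.norm_eq_abs, sq_abs]
          ring
        have hmon : ∀ a : ι ⊕ κ → ℕ, Integrable (fun x => ‖mon a x‖ ^ 2) μ := fun a =>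
          Continuous.integrable_of_hasCompactSupport (by fun_prop)
            (HasCompactSupport.of_compactSpace _)
        have hsub : Integrable (fun x => ‖mon (b' + Pi.single i 1) x‖ ^ 2 -
            2 * c * ‖mon b' x‖ ^ 2) μ := (hmon _).sub ((hmon _).const_mul _)
        simp only [h1]
        rw [integral_add hsub ((hmon _).const_mul _),
          integral_sub (hmon _) ((hmon _).const_mul _), integral_const_mul, integral_const_mul,
          hI, hI, hI]
        have h3 := hrec i b'
        have h4 := hrec i b
        rw [← hb'] at h4
        have h5 : d i b' = d i b + 1 := hd i b
        have h6 : b' i = b i + 1 := by simp [hb']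
        rw [h5, h6] at h3
        rw [h5]
        push_cast at h3 h4 ⊢
        have hIb := hpos b
        have hIb' := hpos b'
        have h7 : c * (d i b + 1 : ℝ) = b i + 1 := by
          rw [hc]; field_simp; linarith
        have h8 : c * I b = I b' := by rw [hc]; field_simp
        have h9 : I (b' + Pi.single i 1) - 2 * c * I b' + c ^ 2 * I b =
            I (b' + Pi.single i 1) - c * I b' := by
          linear_combination c * h8
        rw [h9, le_div_iff₀ (by positivity)]
        have hc0 : 0 < c := by positivity
        have : (I (b' + Pi.single i 1) - c * I b') * (d i b + 1 + 1 : ℝ) =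
            I b' - c * I b' := by
          linear_combination h3 - I b' * h7
        rw [this]
        have := mul_pos hc0 hIb'
        linarith
    obtain ⟨K, hK⟩ := exists_nat_one_div_lt (show (0 : ℝ) < ε ^ 2 by positivity)
    refine ⟨K, fun a ha => le_of_sq_le_sq ?_ (by positivity)⟩
    rw [mul_pow, norm_toL2_sq_eq_integral μ (mon a), hI]
    have h1 : (K : ℝ) ≤ d i a := by exact_mod_cast ha.trans (hmin i a)
    calc _ ≤ I a / (d i a + 1) := hnorm a
      _ ≤ I a / (K + 1) := by gcongr; exact (hpos a).le
      _ = 1 / (K + 1) * I a := by ring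
      _ ≤ _ := by gcongr; exact (hpos a).le

/-- A torus-invariant measure on a product of two spheres for which the monomials are orthogonal
and all continuous symbols are `HankelSmall`. -/
lemma exists_measure_hankelSmall (ι κ : Type) [Fintype ι] [Fintype κ] [Nonempty ι] [Nonempty κ]
    [DecidableEq ι] [DecidableEq κ] :
    ∃ (μ : Measure (SphereProd ι κ)) (_ : IsFiniteMeasure μ),
      (∀ t : ι ⊕ κ → ℂ, (∀ i, ‖t i‖ = 1) → ∃ g : C(SphereProd ι κ, SphereProd ι κ),
        MeasurePreserving g μ μ ∧ ∀ x i, coord i (g x) = t i * coord i x) ∧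
      (∀ a b : ι ⊕ κ → ℕ, a ≠ b → inner ℂ (toL2 μ (mon a)) (toL2 μ (mon b)) = 0) ∧
      (∀ a : ι ⊕ κ → ℕ, toL2 μ (mon a) ≠ 0) ∧
      ∀ f : C(SphereProd ι κ, ℂ), HankelSmall (toL2 μ)
        (fun K => Submodule.span ℂ (mon '' {a | K ≤ minDegree a})) f := by
  obtain ⟨μ, hμ, hinv, I, d, hpos, hI, hrec, hd, hmin⟩ := exists_sphereProd_measure ι κ
  have hI' : ∀ a : ι ⊕ κ → ℕ, ∫ x, ‖mon a x‖ ^ 2 ∂μ = I a := by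
    intro a
    rw [← hI a]
    refine integral_congr_ae (.of_forall fun x => ?_)
    simp only [mon_apply, norm_prod, norm_pow, ← Finset.prod_pow, ← pow_mul, mul_comm]
  have horth : ∀ a b : ι ⊕ κ → ℕ, a ≠ b → inner ℂ (toL2 μ (mon a)) (toL2 μ (mon b)) = 0 := by
    intro a b hab
    obtain ⟨k, hk⟩ := Function.ne_iff.1 hab
    obtain ⟨c, hc, hck⟩ := exists_norm_eq_one_pow_ne hk
    obtain ⟨g, hg, hgx⟩ := hinv (Function.update 1 k c) (norm_update_one k hc)
    have heig : ∀ a x, mon a (g x) = c ^ a k * mon a x := fun a x => by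
      rw [mon_comp _ g hgx, prod_update_one_pow]
    exact inner_toL2_eq_zero μ hg (heig a) (heig b) (by rw [norm_pow, hc, one_pow]) hck
  refine ⟨μ, hμ, hinv, horth, fun a h => ?_, fun f => ?_⟩
  · have h1 := norm_toL2_sq_eq_integral μ (mon a)
    rw [h, hI', norm_zero] at h1
    have := hpos a
    norm_num at h1
    linarith
  · refine hankelSmall_of_separating ?_ (norm_toL2_mul_le μ) coord ?_ ?_ coord_separates f
    · intro K K' h
      exact Submodule.span_mono (Set.image_mono fun a ha => h.trans ha)
    · intro i ε hε K'
      refine ⟨K', fun p hp => ⟨coord i * p, ?_, ?_⟩⟩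
      · induction hp using Submodule.span_induction with
        | mem x hx =>
          obtain ⟨a, ha, rfl⟩ := hx
          rw [coord_mul_mon]
          exact Submodule.subset_span ⟨_, le_trans ha (minDegree_add_single a i).1, rfl⟩
        | zero => rw [mul_zero]; exact Submodule.zero_mem _
        | add x y _ _ hx hy => rw [mul_add]; exact Submodule.add_mem _ hx hy
        | smul a x _ hx => rw [mul_smul_comm]; exact Submodule.smul_mem _ _ hx
      · rw [sub_self, map_zero, norm_zero]; positivity
    · exact hankelSmall_star_coord μ hinv horth I d hpos hI' hrec hd hmin

end SphereProduct

section StiefelFunctions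

open SphereProd

/-- The quaternion `a + b j` for complex numbers `a` and `b`. -/
def quaternionOfComplex (a b : ℂ) : ℍ[ℝ] := ⟨a.re, a.im, b.re, b.im⟩

@[simp] lemma re_quaternionOfComplex (a b : ℂ) : (quaternionOfComplex a b).re = a.re := rfl

@[simp] lemma imI_quaternionOfComplex (a b : ℂ) : (quaternionOfComplex a b).imI = a.im := rfl

@[simp] lemma imJ_quaternionOfComplex (a b : ℂ) : (quaternionOfComplex a b).imJ = b.re := rfl

@[simp] lemma imK_quaternionOfComplex (a b : ℂ) : (quaternionOfComplex a b).imK = b.im := rfl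

lemma continuous_quaternionOfComplex {X : Type*} [TopologicalSpace X] {u v : X → ℂ}
    (hu : Continuous u) (hv : Continuous v) :
    Continuous fun x => quaternionOfComplex (u x) (v x) := by
  have : ∀ x, quaternionOfComplex (u x) (v x) = (u x).re • (⟨1, 0, 0, 0⟩ : ℍ[ℝ]) +
      (u x).im • (⟨0, 1, 0, 0⟩ : ℍ[ℝ]) + (v x).re • (⟨0, 0, 1, 0⟩ : ℍ[ℝ]) +
      (v x).im • (⟨0, 0, 0, 1⟩ : ℍ[ℝ]) := fun x => by
    ext <;> simp [quaternionOfComplex]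
  simp only [this]
  have h1 : Continuous fun x => (u x).re := Complex.continuous_re.comp hu
  have h2 : Continuous fun x => (u x).im := Complex.continuous_im.comp hu
  have h3 : Continuous fun x => (v x).re := Complex.continuous_re.comp hv
  have h4 : Continuous fun x => (v x).im := Complex.continuous_im.comp hv
  exact (((h1.smul continuous_const).add (h2.smul continuous_const)).add
    (h3.smul continuous_const)).add (h4.smul continuous_const)

lemma norm_quaternionOfComplex_sq (a b : ℂ) :
    ‖quaternionOfComplex a b‖ ^ 2 = ‖a‖ ^ 2 + ‖b‖ ^ 2 := by
  rw [sq, ← Quaternion.normSq_eq_norm_mul_self, Quaternion.normSq_def', ← Complex.normSq_eq_norm_sq,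
    ← Complex.normSq_eq_norm_sq, Complex.normSq_apply, Complex.normSq_apply]
  simp only [re_quaternionOfComplex, imI_quaternionOfComplex, imJ_quaternionOfComplex,
    imK_quaternionOfComplex]
  ring

lemma quaternionOfComplex_mul_mul_star (w a b z : ℂ) :
    quaternionOfComplex (w * star z * a) (w * z * b) =
      quaternionOfComplex w 0 * quaternionOfComplex a b * star (quaternionOfComplex z 0) := by
  ext <;> simp <;> ring

lemma quaternionOfComplex_mul (w a b : ℂ) :
    quaternionOfComplex (w * a) (w * b) = quaternionOfComplex w 0 * quaternionOfComplex a b := by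
  ext <;> simp

lemma quaternionOfComplex_re_imI_imJ_imK (q : ℍ[ℝ]) :
    quaternionOfComplex ⟨q.re, q.imI⟩ ⟨q.imJ, q.imK⟩ = q := by
  ext <;> simp

lemma dotProduct_star_eq_sum_norm_sq {k : Type*} [Fintype k] (v : k → ℍ[ℝ]) :
    v ⬝ᵥ star v = ((∑ i, ‖v i‖ ^ 2 : ℝ) : ℍ[ℝ]) := by
  have h : ((∑ i, ‖v i‖ ^ 2 : ℝ) : ℍ[ℝ]) = ∑ i, ((‖v i‖ ^ 2 : ℝ) : ℍ[ℝ]) :=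
    map_sum (algebraMap ℝ ℍ[ℝ]) _ _
  rw [dotProduct, h]
  refine Finset.sum_congr rfl fun i _ => ?_
  rw [Pi.star_apply, Quaternion.self_mul_star, Quaternion.normSq_eq_norm_mul_self, sq]

lemma sum_norm_sq_vecMul_of_mul_conjTranspose {m l : Type*} [Fintype m] [Fintype l]
    [DecidableEq l] (A : Matrix l m ℍ[ℝ]) (hA : A * Aᴴ = 1) (c : l → ℍ[ℝ]) :
    ∑ s, ‖(c ᵥ* A) s‖ ^ 2 = ∑ i, ‖c i‖ ^ 2 := by
  apply Quaternion.coe_injective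
  rw [← dotProduct_star_eq_sum_norm_sq, ← dotProduct_star_eq_sum_norm_sq, star_vecMul,
    ← dotProduct_mulVec, mulVec_mulVec, hA, one_mulVec]

lemma sum_range_two_mul {M : Type*} [AddCommMonoid M] (u : ℕ → M) (n : ℕ) :
    ∑ i ∈ Finset.range n, (u (2 * i) + u (2 * i + 1)) = ∑ i ∈ Finset.range (2 * n), u i := by
  induction n with
  | zero => simp
  | succ n ih => rw [Finset.sum_range_succ, ih, mul_add, mul_one, Finset.sum_range_succ,
      Finset.sum_range_succ, add_assoc]

/-- The inclusion of a complex sphere in a quaternionic sphere. -/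
lemma exists_sphere_inclusion (N n : ℕ) (hN : N ≤ 2 * n) :
    ∃ e : Metric.sphere (0 : EuclideanSpace ℂ (Fin N)) 1 → QSphere n, Continuous e ∧
      ∀ (z : ℂ) (x y : Metric.sphere (0 : EuclideanSpace ℂ (Fin N)) 1),
        (∀ i, y.1 i = z * x.1 i) → ∀ i, (e y).1 i = quaternionOfComplex z 0 * (e x).1 i := by
  let u : Metric.sphere (0 : EuclideanSpace ℂ (Fin N)) 1 → ℕ → ℂ :=
    fun x k => if h : k < N then x.1 ⟨k, h⟩ else 0
  have hu : ∀ k, Continuous fun x => u x k := by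
    intro k
    by_cases h : k < N
    · simp only [u, dif_pos h]; fun_prop
    · simp only [u, dif_neg h]; fun_prop
  have hnorm : ∀ x, ∑ k ∈ Finset.range (2 * n), ‖u x k‖ ^ 2 = 1 := by
    intro x
    have h1 : ‖x.1‖ = 1 := by simp
    have h2 := EuclideanSpace.norm_sq_eq x.1
    rw [h1] at h2
    rw [← Finset.sum_subset (Finset.range_mono hN), Finset.sum_range]
    · rw [← one_pow 2, h2]
      exact Finset.sum_congr rfl fun i _ => by simp [u]
    · intro k _ hk
      have : ¬ k < N := by simpa using hk
      simp [u, this]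
  let v : Metric.sphere (0 : EuclideanSpace ℂ (Fin N)) 1 → PiLp 2 fun _ : Fin n => ℍ[ℝ] :=
    fun x => WithLp.toLp 2 fun i => quaternionOfComplex (u x (2 * i)) (u x (2 * i + 1))
  have hv : Continuous v :=
    (PiLp.continuous_toLp 2 _).comp
      (continuous_pi fun i => continuous_quaternionOfComplex (hu _) (hu _))
  have hmem : ∀ x, v x ∈ Metric.sphere 0 1 := by
    intro x
    rw [mem_sphere_zero_iff_norm, ← sq_eq_sq₀ (norm_nonneg _) zero_le_one, PiLp.norm_sq_eq_of_L2,
      one_pow, ← hnorm x, ← sum_range_two_mul, Finset.sum_range]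
    exact Finset.sum_congr rfl fun i _ => norm_quaternionOfComplex_sq _ _
  refine ⟨fun x => ⟨v x, hmem x⟩, hv.subtype_mk _, ?_⟩
  intro z x y hxy i
  have h1 : ∀ k, u y k = z * u x k := by
    intro k
    by_cases h : k < N
    · simp only [u, dif_pos h, hxy]
    · simp only [u, dif_neg h, mul_zero]
  change quaternionOfComplex (u y _) (u y _) = _ * quaternionOfComplex (u x _) (u x _)
  rw [h1, h1, quaternionOfComplex_mul]

/-- An equivariant map from a quaternionic sphere to a Stiefel manifold gives, by pairing with a
unit quaternionic vector, a unit complex vector with prescribed weights. -/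
lemma exists_equivariant_functions {n m l N : ℕ} (hN : N ≤ 2 * n) (f : QSphere n → QStiefel m l)
    (hf : Continuous f)
    (heq : ∀ (q : ℍ[ℝ]), ‖q‖ = 1 → ∀ (x y : QSphere n),
      (∀ i : Fin n, y.1 i = q * x.1 i) → (f y).1 = q • (f x).1) :
    ∃ Y : Fin m ⊕ Fin m → C(SphereProd (Fin N) (Fin l ⊕ Fin l), ℂ), ∑ i, Y i * star (Y i) = 1 ∧
      ∀ z w : ℂ, ‖z‖ = 1 → ‖w‖ = 1 → ∀ x y : SphereProd (Fin N) (Fin l ⊕ Fin l),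
        (∀ i, coord i y = Sum.elim (fun _ => z)
          (Sum.elim (fun _ => w * star z) fun _ => w * z) i * coord i x) →
        ∀ i, Y i y = w * Y i x := by
  obtain ⟨e, he, hez⟩ := exists_sphere_inclusion N n hN
  let c : SphereProd (Fin N) (Fin l ⊕ Fin l) → Fin l → ℍ[ℝ] := fun x i =>
    quaternionOfComplex (coord (Sum.inr (Sum.inl i)) x) (coord (Sum.inr (Sum.inr i)) x)
  have hc : ∀ i, Continuous fun x => c x i := fun i =>
    continuous_quaternionOfComplex (ContinuousMap.continuous _) (ContinuousMap.continuous _)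
  have hcnorm : ∀ x, ∑ i, ‖c x i‖ ^ 2 = 1 := by
    intro x
    have h1 : ‖x.2.1‖ = 1 := by simp
    have h2 := EuclideanSpace.norm_sq_eq x.2.1
    rw [h1, one_pow, Fintype.sum_sum_type, ← Finset.sum_add_distrib] at h2
    rw [h2]
    exact Finset.sum_congr rfl fun i _ => norm_quaternionOfComplex_sq _ _
  let y : SphereProd (Fin N) (Fin l ⊕ Fin l) → Fin m → ℍ[ℝ] := fun x => c x ᵥ* (f (e x.1)).1
  have hy : ∀ s, Continuous fun x => y x s := by
    intro s
    have h1 : Continuous fun x : SphereProd (Fin N) (Fin l ⊕ Fin l) => (f (e x.1)).1 :=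
      continuous_subtype_val.comp (hf.comp (he.comp continuous_fst))
    have h2 : ∀ i, Continuous fun x => c x i * (f (e x.1)).1 i s :=
      fun i => (hc i).mul (h1.matrix_elem i s)
    exact continuous_finsetSum Finset.univ fun i _ => h2 i
  have hynorm : ∀ x, ∑ s, ‖y x s‖ ^ 2 = 1 := fun x => by
    rw [← hcnorm x]
    exact sum_norm_sq_vecMul_of_mul_conjTranspose _ (f (e x.1)).2 _
  have hcpx : ∀ a b : ℝ, (⟨a, b⟩ : ℂ) = a + b * Complex.I := fun a b => Complex.mk_eq_add_mul_I a b
  refine ⟨Sum.elim (fun s => ⟨fun x => ⟨(y x s).re, (y x s).imI⟩, ?_⟩)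
    (fun s => ⟨fun x => ⟨(y x s).imJ, (y x s).imK⟩, ?_⟩), ?_, ?_⟩
  · simp only [hcpx]
    have h1 := Quaternion.continuous_re.comp (hy s)
    have h2 := Quaternion.continuous_imI.comp (hy s)
    exact (Complex.continuous_ofReal.comp h1).add
      ((Complex.continuous_ofReal.comp h2).mul continuous_const)
  · simp only [hcpx]
    have h1 := Quaternion.continuous_imJ.comp (hy s)
    have h2 := Quaternion.continuous_imK.comp (hy s)
    exact (Complex.continuous_ofReal.comp h1).add
      ((Complex.continuous_ofReal.comp h2).mul continuous_const)
  · ext x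
    have hstar : ∀ a : ℂ, a * star a = ((‖a‖ ^ 2 : ℝ) : ℂ) := fun a => by
      have := RCLike.mul_conj a
      simpa using this
    rw [Fintype.sum_sum_type, ← Finset.sum_add_distrib, ContinuousMap.one_apply]
    simp only [Sum.elim_inl, Sum.elim_inr, ContinuousMap.sum_apply, ContinuousMap.add_apply,
      ContinuousMap.mul_apply, ContinuousMap.star_apply, ContinuousMap.coe_mk, hstar]
    rw [show (1 : ℂ) = ((∑ s, ‖y x s‖ ^ 2 : ℝ) : ℂ) by rw [hynorm, Complex.ofReal_one],
      Complex.ofReal_sum]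
    refine Finset.sum_congr rfl fun s _ => ?_
    have := norm_quaternionOfComplex_sq ⟨(y x s).re, (y x s).imI⟩ ⟨(y x s).imJ, (y x s).imK⟩
    rw [quaternionOfComplex_re_imI_imJ_imK] at this
    exact_mod_cast this.symm
  · intro z w hz hw x x' hxx'
    have hz' : ‖quaternionOfComplex z 0‖ = 1 := by
      rw [← sq_eq_sq₀ (norm_nonneg _) zero_le_one, norm_quaternionOfComplex_sq, hz]; simp
    have hcx : ∀ i, c x' i =
        quaternionOfComplex w 0 * c x i * star (quaternionOfComplex z 0) := by
      intro i
      simp only [c, hxx']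
      exact quaternionOfComplex_mul_mul_star _ _ _ _
    have hfx : (f (e x'.1)).1 = quaternionOfComplex z 0 • (f (e x.1)).1 :=
      heq _ hz' _ _ (hez z _ _ fun i => hxx' (Sum.inl i))
    have hyx : ∀ s, y x' s = quaternionOfComplex w 0 * y x s := by
      intro s
      simp only [y, vecMul, dotProduct, hfx, hcx, Matrix.smul_apply, smul_eq_mul, Finset.mul_sum]
      refine Finset.sum_congr rfl fun i _ => ?_
      have h1 : star (quaternionOfComplex z 0) * quaternionOfComplex z 0 = 1 := by
        rw [Quaternion.star_mul_self, Quaternion.normSq_eq_norm_mul_self, hz']; simp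
      rw [mul_assoc, ← mul_assoc (star _), h1, one_mul, mul_assoc]
    rintro (s | s)
    · simp only [Sum.elim_inl, ContinuousMap.coe_mk, hyx]
      apply Complex.ext <;> simp
    · simp only [Sum.elim_inr, ContinuousMap.coe_mk, hyx]
      apply Complex.ext <;> simp

end StiefelFunctions

lemma card_piAntidiag_univ {ι : Type*} [Fintype ι] [DecidableEq ι] (n : ℕ) :
    (Finset.piAntidiag (Finset.univ : Finset ι) n).card = (Fintype.card ι).multichoose n := by
  rw [← Sym.card_sym_eq_multichoose, ← Fintype.card_coe]
  exact Fintype.card_congr ((Sym.equivNatSumOfFintype ι n).trans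
    (Equiv.subtypeEquivRight fun a => by simp)).symm

lemma exists_bidegree_finset (l N j k : ℕ) (hjk : j ≤ k) :
    ∃ S : Finset (Fin N ⊕ (Fin l ⊕ Fin l) → ℕ),
      (∀ a, a ∈ S ↔ ∑ i, a (.inr (.inl i)) + ∑ i, a (.inr (.inr i)) = j ∧
        ∑ i, a (.inl i) + ∑ i, a (.inr (.inr i)) = k + ∑ i, a (.inr (.inl i))) ∧
      (S.card : ℤ) = bidegreeCount l N j k := by
  classical
  let P : (_ : ℕ × ℕ) × ((Fin l → ℕ) × (Fin l → ℕ) × (Fin N → ℕ)) →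
    (Fin N ⊕ (Fin l ⊕ Fin l) → ℕ) := fun p => Sum.elim p.2.2.2 (Sum.elim p.2.1 p.2.2.1)
  let B : Finset ((_ : ℕ × ℕ) × ((Fin l → ℕ) × (Fin l → ℕ) × (Fin N → ℕ))) :=
    (Finset.HasAntidiagonal.antidiagonal j).sigma fun p =>
      Finset.piAntidiag Finset.univ p.1 ×ˢ Finset.piAntidiag Finset.univ p.2 ×ˢ
        Finset.piAntidiag Finset.univ (k + p.1 - p.2)
  have hB : ∀ p, p ∈ B ↔ p.1.1 + p.1.2 = j ∧ ∑ i, p.2.1 i = p.1.1 ∧ ∑ i, p.2.2.1 i = p.1.2 ∧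
      ∑ i, p.2.2.2 i = k + p.1.1 - p.1.2 := by
    intro p
    simp [B]
  have hinj : Set.InjOn P B := by
    rintro ⟨⟨p₁, p₂⟩, u, v, x⟩ hp ⟨⟨q₁, q₂⟩, u', v', x'⟩ hq h
    rw [Finset.mem_coe, hB] at hp hq
    have h1 : u = u' := funext fun i => congrFun h (.inr (.inl i))
    have h2 : v = v' := funext fun i => congrFun h (.inr (.inr i))
    have h3 : x = x' := funext fun i => congrFun h (.inl i)
    subst h1 h2 h3
    simp only at hp hq
    obtain rfl : p₁ = q₁ := hp.2.1.symm.trans hq.2.1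
    obtain rfl : p₂ = q₂ := hp.2.2.1.symm.trans hq.2.2.1
    rfl
  refine ⟨B.image P, fun a => ?_, ?_⟩
  · rw [Finset.mem_image]
    constructor
    · rintro ⟨p, hp, rfl⟩
      rw [hB] at hp
      simp only [P, Sum.elim_inl, Sum.elim_inr]
      omega
    · intro h
      refine ⟨⟨(∑ i, a (.inr (.inl i)), ∑ i, a (.inr (.inr i))), fun i => a (.inr (.inl i)),
        fun i => a (.inr (.inr i)), fun i => a (.inl i)⟩, ?_, ?_⟩
      · rw [hB]
        refine ⟨h.1, rfl, rfl, ?_⟩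
        change ∑ i, a (.inl i) = k + ∑ i, a (.inr (.inl i)) - ∑ i, a (.inr (.inr i))
        omega
      · funext i
        rcases i with i | i | i <;> rfl
  · rw [Finset.card_image_of_injOn hinj, Finset.card_sigma, bidegreeCount]
    push_cast
    refine Finset.sum_congr rfl fun p _ => ?_
    simp only [Finset.card_product, card_piAntidiag_univ, Fintype.card_fin]
    push_cast
    ring

section Weights

open SphereProd MeasureTheory

/-- The weights of the two commuting circle actions on the coordinates. -/
def coordWeight {l N : ℕ} (z w : ℂ) : Fin N ⊕ (Fin l ⊕ Fin l) → ℂ :=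
  Sum.elim (fun _ => z) (Sum.elim (fun _ => w * star z) fun _ => w * z)

lemma norm_coordWeight {l N : ℕ} {z w : ℂ} (hz : ‖z‖ = 1) (hw : ‖w‖ = 1)
    (i : Fin N ⊕ (Fin l ⊕ Fin l)) : ‖coordWeight z w i‖ = 1 := by
  rcases i with i | i | i <;> simp [coordWeight, hz, hw]

lemma prod_coordWeight_pow {l N : ℕ} (z w : ℂ) (a : Fin N ⊕ (Fin l ⊕ Fin l) → ℕ) :
    ∏ i, coordWeight z w i ^ a i =
      w ^ (∑ i, a (.inr (.inl i)) + ∑ i, a (.inr (.inr i))) *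
        (z ^ (∑ i, a (.inl i) + ∑ i, a (.inr (.inr i))) *
          star z ^ (∑ i, a (.inr (.inl i)))) := by
  simp only [Fintype.prod_sum_type, coordWeight, Sum.elim_inl, Sum.elim_inr,
    Finset.prod_mul_distrib, Finset.prod_pow_eq_pow_sum, pow_add, mul_pow]
  ring

/-- A family of complex functions of weight one which is a unit vector at each point cannot exist,
by an index computation. -/
lemma not_exists_equivariant_functions {r l : ℕ} (hl : 1 ≤ l)
    (Y : Fin (2 * (r + l)) → C(SphereProd (Fin (2 * r + 3)) (Fin l ⊕ Fin l), ℂ))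
    (hY : ∑ i, Y i * star (Y i) = 1)
    (hYw : ∀ z w : ℂ, ‖z‖ = 1 → ‖w‖ = 1 → ∀ x y,
      (∀ i, coord i y = coordWeight z w i * coord i x) → ∀ i, Y i y = w * Y i x) : False := by
  have : Nonempty (Fin l ⊕ Fin l) := ⟨.inl ⟨0, hl⟩⟩
  obtain ⟨μ, hμ, hinv, horth, hne, hH⟩ :=
    exists_measure_hankelSmall (Fin (2 * r + 3)) (Fin l ⊕ Fin l)
  obtain ⟨V, _, _, deg, D, hD, hDD, hDcase, hdeg, hcount⟩ :=
    exists_clifford_matrix (2 * (r + l)) Y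
  have hunit : ∀ z : ℂ, ‖z‖ = 1 → star z * z = 1 := fun z hz => by
    have := RCLike.conj_mul z
    rw [hz] at this
    simpa using this
  obtain ⟨K₀, hK₀⟩ := exists_card_eq_of_hankelSmall (T := toL2 μ) mon minDegree horth hne
    (inner_toL2_mul_right μ) D (by rw [hD, hDD, hY, one_smul]) (fun u v => hH _)
    (fun v => Even (deg v)) (by
      intro u v huv
      rcases hDcase u v with h | ⟨h, _⟩ | ⟨h, _⟩
      · exact h
      · rw [h, Nat.even_add_one] at huv; tauto
      · rw [h, Nat.even_add_one] at huv; tauto)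
  obtain ⟨k, hk, hsum⟩ := alternating_sum_bidegreeCount_ne_zero r l K₀
    (K₀ + (K₀ + 2 * (r + l))) hl
  choose F hF hFcard using fun v => exists_bidegree_finset l (2 * r + 3) (K₀ + deg v) k
    (by have := hdeg v; omega)
  have hDw : ∀ z w : ℂ, ‖z‖ = 1 → ‖w‖ = 1 → ∀ x y,
      (∀ i, coord i y = coordWeight z w i * coord i x) → ∀ u v,
        w ^ deg v * D u v y = w ^ deg u * D u v x := by
    intro z w hz hw x y hxy u v
    have hYy := hYw z w hz hw x y hxy
    rcases hDcase u v with h | ⟨h, i, h' | h'⟩ | ⟨h, i, h' | h'⟩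
    · simp [h]
    · rw [h', h, hYy]; ring
    · rw [h', h, ContinuousMap.neg_apply, ContinuousMap.neg_apply, hYy]; ring
    · rw [h', h, ContinuousMap.star_apply, ContinuousMap.star_apply, hYy, star_mul']
      linear_combination w ^ deg u * star (Y i x) * hunit w hw
    · rw [h', h, ContinuousMap.neg_apply, ContinuousMap.neg_apply, ContinuousMap.star_apply,
        ContinuousMap.star_apply, hYy, star_mul']
      linear_combination -w ^ deg u * star (Y i x) * hunit w hw
  have hcard := hK₀ F ?_ ?_
  · apply hsum
    have h1 := hcount fun i => (-1) ^ i * bidegreeCount l (2 * r + 3) (K₀ + i) k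
    rw [← h1, ← Finset.sum_filter_add_sum_filter_not _ (fun v => Even (deg v))]
    have h2 : ∑ v with Even (deg v), (-1) ^ deg v * bidegreeCount l (2 * r + 3) (K₀ + deg v) k =
        ((∑ v with Even (deg v), (F v).card : ℕ) : ℤ) := by
      push_cast
      refine Finset.sum_congr rfl fun v hv => ?_
      rw [(Finset.mem_filter.1 hv).2.neg_one_pow, one_mul, hFcard]
    have h3 : ∑ v with ¬ Even (deg v),
        (-1) ^ deg v * bidegreeCount l (2 * r + 3) (K₀ + deg v) k =
        -((∑ v with ¬ Even (deg v), (F v).card : ℕ) : ℤ) := by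
      push_cast
      rw [← Finset.sum_neg_distrib]
      refine Finset.sum_congr rfl fun v hv => ?_
      rw [(Nat.not_even_iff_odd.1 (Finset.mem_filter.1 hv).2).neg_one_pow, neg_one_mul, hFcard]
    rw [h2, h3, hcard, add_neg_cancel]
  · intro v a ha
    rw [hF] at ha
    have := hdeg v
    rw [minDegree, Fintype.sum_sum_type]
    refine le_min ?_ ?_ <;> omega
  · intro u v a ha b hb
    rw [hF] at ha hb
    have hred : ∀ z w : ℂ, ‖z‖ = 1 → ‖w‖ = 1 →
        (∏ i, coordWeight z w i ^ b i) ≠ w ^ (K₀ + deg u) * z ^ k →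
        inner ℂ (toL2 μ (mon b)) (toL2 μ (D u v * mon a)) = 0 := by
      intro z w hz hw hzw
      obtain ⟨g, hg, hgx⟩ := hinv (coordWeight z w) (norm_coordWeight hz hw)
      refine inner_toL2_eq_zero μ hg (mon_comp _ g hgx b) (c₂ := w ^ (K₀ + deg u) * z ^ k) ?_ ?_ hzw
      · intro x
        rw [ContinuousMap.mul_apply, ContinuousMap.mul_apply, mon_comp _ g hgx,
          prod_coordWeight_pow, ha.1, ha.2, pow_add z, mul_assoc (z ^ k), ← mul_pow, mul_comm z,
          hunit z hz, one_pow]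
        linear_combination w ^ K₀ * z ^ k * mon a x * hDw z w hz hw x (g x) (hgx x) u v
      · rw [norm_prod]
        exact Finset.prod_eq_one fun i _ => by rw [norm_pow, norm_coordWeight hz hw, one_pow]
    by_cases h : ∑ i, b (.inr (.inl i)) + ∑ i, b (.inr (.inr i)) = K₀ + deg u
    · obtain ⟨z, hz, hzne⟩ := exists_norm_eq_one_pow_ne fun h' => hb ⟨h, h'⟩
      refine hred z 1 hz norm_one fun h' => hzne ?_
      rw [prod_coordWeight_pow, one_pow, one_pow, one_mul, one_mul] at h'
      rw [pow_add z k, ← h', mul_assoc, ← mul_pow, hunit z hz, one_pow, mul_one]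
    · obtain ⟨w, hw, hwne⟩ := exists_norm_eq_one_pow_ne h
      refine hred 1 w norm_one hw fun h' => hwne ?_
      rw [prod_coordWeight_pow] at h'
      simpa using h'

end Weights

/-- If there exists an `S³`-equivariant continuous map `S^{4n-1} → ℍV_{m,l}`
(equivariant for the left unit-quaternion actions), then `n ≤ m - l + 1`. -/
theorem stmt4 (n m l : ℕ) (hn : 1 ≤ n) (hl : 1 ≤ l) (hlm : l ≤ m)
    (f : QSphere n → QStiefel m l) (hf : Continuous f)
    (heq : ∀ (q : ℍ[ℝ]), ‖q‖ = 1 → ∀ (x y : QSphere n),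
      (∀ i : Fin n, y.1 i = q * x.1 i) → (f y).1 = q • (f x).1) :
    n ≤ m - l + 1 := by
  by_contra! hlt
  obtain ⟨r, rfl⟩ := Nat.exists_eq_add_of_le' hlm
  obtain ⟨Y, hY, hYw⟩ := exists_equivariant_functions (N := 2 * r + 3) (by omega) f hf heq
  let σ : Fin (2 * (r + l)) ≃ Fin (r + l) ⊕ Fin (r + l) :=
    (finCongr (two_mul _)).trans finSumFinEquiv.symm
  refine not_exists_equivariant_functions hl (fun i => Y (σ i)) ?_
    fun z w hz hw x y hxy i => hYw z w hz hw x y hxy (σ i)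
  rw [σ.sum_comp fun i => Y i * star (Y i), hY]
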